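/- Let (μ_j) be any sequence with μ_j → ∞ and for each j let (u_j, v_j) be a minimizer of m_{1,μ_j}, i.e. (u_j, v_j) ∈ S₁ × S₁ with Q(u_j, v_j) = 0 and J_{μ_j}(u_j, v_j) = m_{1,μ_j}. Then there exists j₀ such that for all j > j₀ one has (u_j)_y = 0 and (v_j)_y = 0 almost everywhere, i.e. u_j and v_j are independent of the y-variable. -/

import Mathlib

noncomputable section

open MeasureTheory Real Filter

namespace Waveguide

/-- A point of the waveguide `ℝ³ × 𝕋`, modelled as `ℝ³ × ℝ` with functions that are
`2π`-periodic in the second coordinate. -/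
abbrev Pt : Type := (Fin 3 → ℝ) × ℝ

/-- The fundamental domain `ℝ³ × (0, 2π]` of the waveguide `ℝ³ × 𝕋`. -/
def Dom : Set Pt := Set.univ ×ˢ Set.Ioc 0 (2 * π)

/-- `2π`-periodicity in the `y` variable. -/
def PeriodicY (u : Pt → ℝ) : Prop := ∀ x y, u (x, y + 2 * π) = u (x, y)

/-- The `i`-th horizontal coordinate direction. -/
def ex (i : Fin 3) : Pt := (fun j => if j = i then 1 else 0, 0)

/-- The vertical (periodic) direction. -/
def ey : Pt := (0, 1)

/-- `i`-th partial derivative in the `x` variables. -/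
def gradx (u : Pt → ℝ) (p : Pt) (i : Fin 3) : ℝ := fderiv ℝ u p (ex i)

/-- Partial derivative in the `y` variable, `u_y`. -/
def grady (u : Pt → ℝ) (p : Pt) : ℝ := fderiv ℝ u p ey

/-- `|∇_x u|²`. -/
def gradSqX (u : Pt → ℝ) (p : Pt) : ℝ := ∑ i, (gradx u p i) ^ 2

/-- `|∇_{x,y} u|²`. -/
def gradSq (u : Pt → ℝ) (p : Pt) : ℝ := gradSqX u p + (grady u p) ^ 2

/-- Membership in (a regular repesentative of) `H¹(ℝ³ × 𝕋)`, for real valued functions. -/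
structure H1 (u : Pt → ℝ) : Prop where
  periodic : PeriodicY u
  diff : Differentiable ℝ u
  memL2 : IntegrableOn (fun p => (u p) ^ 2) Dom
  memGrad : IntegrableOn (fun p => gradSq u p) Dom
  memL4 : IntegrableOn (fun p => (u p) ^ 4) Dom

/-- The `L²(ℝ³ × 𝕋)` norm. -/
def l2 (u : Pt → ℝ) : ℝ := Real.sqrt (∫ p in Dom, (u p) ^ 2)

/-- `u ∈ S_Θ`. -/
def inS (Θ : ℝ) (u : Pt → ℝ) : Prop := H1 u ∧ l2 u = Θ

/-- The nonlinear density `u⁴ + 2u²v² + v⁴`. -/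
def nonlin (u v : Pt → ℝ) (p : Pt) : ℝ :=
  (u p) ^ 4 + 2 * (u p) ^ 2 * (v p) ^ 2 + (v p) ^ 4

/-- The energy functional `I(u,v)`. -/
def energy (u v : Pt → ℝ) : ℝ :=
  (1 / 2) * (∫ p in Dom, (gradSq u p + gradSq v p))
    - (1 / 4) * ∫ p in Dom, nonlin u v p

/-- The semivirial functional `Q(u,v)`. -/
def svirial (u v : Pt → ℝ) : ℝ :=
  (∫ p in Dom, (gradSqX u p + gradSqX v p))
    - (3 / 4) * ∫ p in Dom, nonlin u v p

/-- The ground-state level `m_Θ`. -/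
def mlevel (Θ : ℝ) : ℝ :=
  sInf {c | ∃ u v : Pt → ℝ, inS Θ u ∧ inS Θ v ∧ svirial u v = 0 ∧ energy u v = c}

/-- `(u,v)` is a minimizer of `m_Θ`: it lies in `V_Θ` and attains the infimum. -/
def isMinimizer (Θ : ℝ) (u v : Pt → ℝ) : Prop :=
  inS Θ u ∧ inS Θ v ∧ svirial u v = 0 ∧ energy u v = mlevel Θ

/-- Smooth, compactly supported (in `x`) test function on the waveguide. -/
def TestFun (φ : Pt → ℝ) : Prop :=
  ContDiff ℝ (⊤ : ℕ∞) φ ∧ PeriodicY φ ∧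
    ∃ K : Set (Fin 3 → ℝ), IsCompact K ∧ ∀ p : Pt, p.1 ∉ K → φ p = 0

/-- `u` is a weak solution of `-Δ_{x,y} u + lam u = f` on `ℝ³ × 𝕋`. -/
def WeakSol (lam : ℝ) (u f : Pt → ℝ) : Prop :=
  ∀ φ : Pt → ℝ, TestFun φ →
    (∫ p in Dom,
        ((∑ i, gradx u p i * gradx φ p i) + grady u p * grady φ p + lam * u p * φ p))
      = ∫ p in Dom, f p * φ p

/-- The mass-preserving rescaling `u^τ(x,y) = τ^{3/2} u(τx, y)`. -/
def scaleX (τ : ℝ) (u : Pt → ℝ) : Pt → ℝ :=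
  fun p => τ ^ ((3 : ℝ) / 2) * u (τ • p.1, p.2)

/-- `u` is independent of the `y` variable, i.e. `u_y = 0` (a.e.). -/
def Yindep (u : Pt → ℝ) : Prop := ∀ᵐ p : Pt ∂volume, grady u p = 0

/-- The functional `J_μ(u,v)`. -/
def Jfun (μ : ℝ) (u v : Pt → ℝ) : ℝ :=
  (1 / 2) * (∫ p in Dom,
      (gradSqX u p + μ * (grady u p) ^ 2 + gradSqX v p + μ * (grady v p) ^ 2))
    - (1 / 4) * ∫ p in Dom, nonlin u v p

/-- The level `m_{1,μ}`. -/
def m1 (μ : ℝ) : ℝ :=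
  sInf {c | ∃ u v : Pt → ℝ, inS 1 u ∧ inS 1 v ∧ svirial u v = 0 ∧ Jfun μ u v = c}

/-- `(u,v)` is a minimizer of `m_{1,μ}`. -/
def isMinimizerJ (μ : ℝ) (u v : Pt → ℝ) : Prop :=
  inS 1 u ∧ inS 1 v ∧ svirial u v = 0 ∧ Jfun μ u v = m1 μ

/-! ### Objects on `ℝ³` -/

abbrev Pt3 : Type := Fin 3 → ℝ

def e3 (i : Fin 3) : Pt3 := fun j => if j = i then 1 else 0

def grad3 (w : Pt3 → ℝ) (x : Pt3) (i : Fin 3) : ℝ := fderiv ℝ w x (e3 i)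

def gradSq3 (w : Pt3 → ℝ) (x : Pt3) : ℝ := ∑ i, (grad3 w x i) ^ 2

/-- Membership in (a regular representative of) `H¹(ℝ³)`. -/
structure H1R3 (w : Pt3 → ℝ) : Prop where
  diff : Differentiable ℝ w
  memL2 : Integrable (fun x => (w x) ^ 2)
  memGrad : Integrable (fun x => gradSq3 w x)
  memL4 : Integrable (fun x => (w x) ^ 4)

/-- The `L²(ℝ³)` norm. -/
def l2R3 (w : Pt3 → ℝ) : ℝ := Real.sqrt (∫ x, (w x) ^ 2)

def nonlin3 (u v : Pt3 → ℝ) (x : Pt3) : ℝ :=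
  (u x) ^ 4 + 2 * (u x) ^ 2 * (v x) ^ 2 + (v x) ^ 4

/-- The limit energy `Î(u,v)` on `ℝ³`. -/
def Ihat (u v : Pt3 → ℝ) : ℝ :=
  (1 / 2) * (∫ x, (gradSq3 u x + gradSq3 v x)) - (1 / 4) * ∫ x, nonlin3 u v x

/-- The virial `Q̂(u,v)` on `ℝ³`. -/
def Qhat (u v : Pt3 → ℝ) : ℝ :=
  (∫ x, (gradSq3 u x + gradSq3 v x)) - (3 / 4) * ∫ x, nonlin3 u v x

/-- The ground-state energy `m̂_ρ` on `ℝ³`. -/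
def mhat (ρ : ℝ) : ℝ :=
  sInf {c | ∃ u v : Pt3 → ℝ, H1R3 u ∧ H1R3 v ∧ l2R3 u = ρ ∧ l2R3 v = ρ ∧
    Qhat u v = 0 ∧ Ihat u v = c}

/-- The `[0, ∞]`-valued squared gradient on `ℝ³`. -/
def eGradSq3 (w : Pt3 → ℝ) (x : Pt3) : ENNReal := ∑ i, ‖grad3 w x i‖ₑ ^ 2

theorem measurable_grad3 (w : Pt3 → ℝ) (i : Fin 3) : Measurable fun x => grad3 w x i :=
  measurable_fderiv_apply_const ℝ w (e3 i)

theorem measurable_eGradSq3 (w : Pt3 → ℝ) : Measurable (eGradSq3 w) :=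
  Finset.measurable_fun_sum _ fun i _ => (measurable_grad3 w i).enorm.pow_const 2

theorem enorm_sub_le_lintegral_deriv {g : ℝ → ℝ} (hg : Differentiable ℝ g) (a b : ℝ) :
    ‖g b - g a‖ₑ ≤ ∫⁻ t in Set.uIoc a b, ‖deriv g t‖ₑ := by
  by_cases hi : IntegrableOn (deriv g) (Set.uIoc a b)
  · rw [← intervalIntegral.integral_eq_sub_of_hasDerivAt
      (fun t _ => (hg t).hasDerivAt) (intervalIntegrable_iff.mpr hi)]
    calc ‖∫ t in a..b, deriv g t‖ₑ = ‖∫ t in Set.uIoc a b, deriv g t‖ₑ := by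
          rw [← ofReal_norm, ← ofReal_norm, intervalIntegral.norm_intervalIntegral_eq]
      _ ≤ _ := enorm_integral_le_lintegral_enorm _
  · have : ∫⁻ t in Set.uIoc a b, ‖deriv g t‖ₑ = ⊤ := by
      by_contra h
      exact hi ⟨(measurable_deriv g).aestronglyMeasurable, lt_top_iff_ne_top.mpr h⟩
    rw [this]; exact le_top

theorem e3_eq_single (i : Fin 3) : e3 i = Pi.single i 1 := by
  funext j; simp [e3, Pi.single_apply]

theorem enorm_pow_four_le_lintegral_line {g : Pt3 → ℝ} (hg : Differentiable ℝ g)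
    (hc : HasCompactSupport g) (x : Pt3) (i : Fin 3) :
    ‖g x‖ₑ ^ 4 ≤ ∫⁻ t, 4 * ‖g (Function.update x i t)‖ₑ ^ 3 *
      ‖grad3 g (Function.update x i t) i‖ₑ := by
  obtain ⟨R, hR⟩ := hc.isBounded.subset_closedBall (0 : Pt3)
  have hzero : g (Function.update x i (|R| + 1)) = 0 := by
    by_contra hne
    have h1 := hR (subset_tsupport g hne)
    have h2 := (norm_le_pi_norm (Function.update x i (|R| + 1)) i)
    rw [mem_closedBall_zero_iff] at h1
    simp only [Function.update_self, norm_eq_abs] at h2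
    rw [abs_of_nonneg (by positivity)] at h2
    linarith [le_abs_self R]
  have hd : ∀ t, HasDerivAt (fun t => g (Function.update x i t) ^ 4)
      (4 * g (Function.update x i t) ^ 3 * grad3 g (Function.update x i t) i) t := by
    intro t
    have h1 := (hg (Function.update x i t)).hasFDerivAt.comp_hasDerivAt t
      (hasDerivAt_update x i t)
    rw [← e3_eq_single] at h1
    have h2 : HasDerivAt (fun t => g (Function.update x i t))
      (grad3 g (Function.update x i t) i) t := h1
    simpa using h2.fun_pow 4
  have h := enorm_sub_le_lintegral_deriv (fun t => (hd t).differentiableAt) (|R| + 1) (x i)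
  simp only [Function.update_eq_self, hzero] at h
  calc ‖g x‖ₑ ^ 4 = ‖g x ^ 4 - 0 ^ 4‖ₑ := by simp
    _ ≤ _ := h
    _ ≤ ∫⁻ t, ‖deriv (fun t => g (Function.update x i t) ^ 4) t‖ₑ :=
        setLIntegral_le_lintegral _ _
    _ = _ := by
        refine lintegral_congr fun t => ?_
        rw [(hd t).deriv, enorm_mul, enorm_mul, enorm_pow]
        congr 2
        rw [← ofReal_norm]; simp

theorem enorm_grad3_le (w : Pt3 → ℝ) (x : Pt3) (i : Fin 3) :
    ‖grad3 w x i‖ₑ ≤ eGradSq3 w x ^ ((1 : ℝ) / 2) := by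
  rw [one_div, ENNReal.le_rpow_inv_iff (by norm_num)]
  have : ‖grad3 w x i‖ₑ ^ (2 : ℝ) = ‖grad3 w x i‖ₑ ^ 2 := by
    exact_mod_cast ENNReal.rpow_natCast _ 2
  rw [this]
  exact Finset.single_le_sum (f := fun i => ‖grad3 w x i‖ₑ ^ 2) (fun _ _ => zero_le) (Finset.mem_univ i)

theorem lintegral_pow_six_le_of_hasCompactSupport {g : Pt3 → ℝ} (hg : Differentiable ℝ g)
    (hc : HasCompactSupport g) :
    ∫⁻ x, ‖g x‖ₑ ^ 6 ≤ 4096 * (∫⁻ x, eGradSq3 g x) ^ 3 := by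
  set S := ∫⁻ x, ‖g x‖ₑ ^ 6 with hS
  set G := ∫⁻ x, eGradSq3 g x with hG
  have hgm : Measurable fun x => ‖g x‖ₑ := hg.continuous.measurable.enorm
  set f : Pt3 → ENNReal := fun x => 4 * ‖g x‖ₑ ^ 3 * eGradSq3 g x ^ ((1 : ℝ) / 2) with hf
  have hfm : Measurable f :=
    ((hgm.pow_const 3).const_mul 4).mul ((measurable_eGradSq3 g).pow_const _)
  have hS_ne_top : S ≠ ⊤ := by
    have hc6 : HasCompactSupport (fun x => g x ^ 6) := hc.mono fun x hx => by
      contrapose! hx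
      simp_all
    have hi : Integrable (fun x => g x ^ 6) :=
      Continuous.integrable_of_hasCompactSupport (hg.continuous.pow 6) hc6
    have := hi.2
    simp only [HasFiniteIntegral, enorm_pow] at this
    exact this.ne
  have h1 : S ≤ (∫⁻ x, f x) ^ ((3 : ℝ) / 2) := by
    have hp : Real.HolderConjugate (Fintype.card (Fin 3)) ((3 : ℝ) / 2) := by
      rw [Real.holderConjugate_iff]; norm_num
    refine le_trans ?_ (lintegral_prod_lintegral_pow_le (fun _ : Fin 3 => (volume : Measure ℝ)) hp hfm)
    rw [hS, ← volume_pi]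
    refine lintegral_mono fun x => ?_
    have key : ∀ i : Fin 3, ‖g x‖ₑ ^ 2 ≤
        (∫⁻ t, f (Function.update x i t)) ^ ((1 : ℝ) / ((Fintype.card (Fin 3) : ℝ) - 1)) := by
      intro i
      have h2 : (1 : ℝ) / ((Fintype.card (Fin 3) : ℝ) - 1) = 1 / 2 := by norm_num
      rw [h2, one_div, ENNReal.le_rpow_inv_iff (by norm_num)]
      calc (‖g x‖ₑ ^ 2) ^ (2 : ℝ) = ‖g x‖ₑ ^ 4 := by
            rw [show (2 : ℝ) = ((2 : ℕ) : ℝ) by norm_num, ENNReal.rpow_natCast, ← pow_mul]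
        _ ≤ _ := enorm_pow_four_le_lintegral_line hg hc x i
        _ ≤ _ := by
            refine lintegral_mono fun t => ?_
            exact mul_le_mul_right (enorm_grad3_le _ _ _) _
    calc ‖g x‖ₑ ^ 6 = ∏ _i : Fin 3, ‖g x‖ₑ ^ 2 := by
          simp [← pow_mul]
      _ ≤ _ := Finset.prod_le_prod' fun i _ => key i
  have h2 : ∫⁻ x, f x ≤ 4 * (S ^ ((1 : ℝ) / 2) * G ^ ((1 : ℝ) / 2)) := by
    have hh := ENNReal.lintegral_mul_le_Lp_mul_Lq volume Real.HolderConjugate.two_two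
      (hgm.pow_const 3).aemeasurable ((measurable_eGradSq3 g).pow_const ((1 : ℝ) / 2)).aemeasurable
    have e1 : ∀ x, (‖g x‖ₑ ^ 3) ^ (2 : ℝ) = ‖g x‖ₑ ^ 6 := fun x => by
      rw [show (2 : ℝ) = ((2 : ℕ) : ℝ) by norm_num, ENNReal.rpow_natCast, ← pow_mul]
    have e2 : ∀ x, (eGradSq3 g x ^ ((1 : ℝ) / 2)) ^ (2 : ℝ) = eGradSq3 g x := fun x => by
      rw [← ENNReal.rpow_mul]; norm_num
    simp only [e1, e2, Pi.mul_apply] at hh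
    simp only [hf, mul_assoc]
    rw [lintegral_const_mul' _ _ (by norm_num)]
    exact mul_le_mul_right hh 4
  have h3 : S ^ 4 ≤ 4096 * S ^ 3 * G ^ 3 := by
    have h4 : S ≤ (4 * (S ^ ((1 : ℝ) / 2) * G ^ ((1 : ℝ) / 2))) ^ ((3 : ℝ) / 2) :=
      h1.trans (ENNReal.rpow_le_rpow h2 (by norm_num))
    calc S ^ 4 ≤ ((4 * (S ^ ((1 : ℝ) / 2) * G ^ ((1 : ℝ) / 2))) ^ ((3 : ℝ) / 2)) ^ 4 := by
          gcongr
      _ = (4 * (S ^ ((1 : ℝ) / 2) * G ^ ((1 : ℝ) / 2))) ^ 6 := by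
          rw [← ENNReal.rpow_natCast, ← ENNReal.rpow_mul, ← ENNReal.rpow_natCast]; norm_num
      _ = 4096 * S ^ 3 * G ^ 3 := by
          have e : ∀ a : ENNReal, (a ^ ((1 : ℝ) / 2)) ^ 6 = a ^ 3 := fun a => by
            rw [← ENNReal.rpow_natCast, ← ENNReal.rpow_mul, ← ENNReal.rpow_natCast]; norm_num
          rw [mul_pow, mul_pow, e, e]; norm_num [mul_assoc]
  rcases eq_or_ne S 0 with h0 | h0
  · rw [h0]; exact zero_le
  · have h5 : S ^ 3 ≠ 0 := pow_ne_zero _ h0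
    have h6 : S ^ 3 ≠ ⊤ := ENNReal.pow_ne_top hS_ne_top
    rw [show S ^ 4 = S ^ 3 * S by ring, show 4096 * S ^ 3 * G ^ 3 = S ^ 3 * (4096 * G ^ 3) by ring]
      at h3
    exact (ENNReal.mul_le_mul_iff_right h5 h6).mp h3

theorem enorm_add_sq_le (a b : ℝ) : ‖a + b‖ₑ ^ 2 ≤ 2 * ‖a‖ₑ ^ 2 + 2 * ‖b‖ₑ ^ 2 := by
  have h : ‖a + b‖ₑ ^ 2 = ENNReal.ofReal ((a + b) ^ 2) := by
    rw [← enorm_pow, Real.enorm_of_nonneg (sq_nonneg _)]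
  have h2 : 2 * ‖a‖ₑ ^ 2 + 2 * ‖b‖ₑ ^ 2 = ENNReal.ofReal (2 * a ^ 2 + 2 * b ^ 2) := by
    rw [ENNReal.ofReal_add (by positivity) (by positivity), ENNReal.ofReal_mul (by norm_num),
      ENNReal.ofReal_mul (by norm_num), ← enorm_pow, ← enorm_pow,
      Real.enorm_of_nonneg (sq_nonneg _), Real.enorm_of_nonneg (sq_nonneg _)]
    norm_num
  rw [h, h2]
  exact ENNReal.ofReal_le_ofReal (by nlinarith [sq_nonneg (a - b)])

/-- The Sobolev inequality `‖f‖₆² ≤ C ‖∇f‖₂²` on `ℝ³` for differentiable functions in `L²`. -/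
theorem lintegral_pow_six_le {f : Pt3 → ℝ} (hf : Differentiable ℝ f)
    (h2 : ∫⁻ x, ‖f x‖ₑ ^ 2 ≠ ⊤) :
    ∫⁻ x, ‖f x‖ₑ ^ 6 ≤ 32768 * (∫⁻ x, eGradSq3 f x) ^ 3 := by
  let χ : ContDiffBump (0 : Pt3) := ⟨1, 2, by norm_num, by norm_num⟩
  have hχ : Differentiable ℝ χ := χ.contDiff.differentiable (n := 1) (by norm_num)
  obtain ⟨K, hK⟩ : ∃ K : ℝ, ∀ x i, ‖grad3 χ x i‖ ≤ K := by
    obtain ⟨C, hC⟩ := (χ.hasCompactSupport.fderiv ℝ).exists_bound_of_continuous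
      (χ.contDiff.continuous_fderiv (n := 1) (by norm_num))
    have hC0 : 0 ≤ C := (norm_nonneg _).trans (hC 0)
    refine ⟨C, fun x i => ((fderiv ℝ χ x).le_opNorm (e3 i)).trans ?_⟩
    have : ‖e3 i‖ ≤ 1 := by
      rw [pi_norm_le_iff_of_nonneg (by norm_num)]
      intro j; simp only [e3]; split_ifs <;> simp
    calc ‖fderiv ℝ χ x‖ * ‖e3 i‖ ≤ C * 1 := by gcongr; exact hC x
      _ = C := mul_one C
  set r : ℕ → ℝ := fun n => ((n : ℝ) + 1)⁻¹ with hr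
  have hr0 : ∀ n, 0 < r n := fun n => by positivity
  have hrt : Tendsto r atTop (nhds 0) := by
    simpa [hr, one_div] using tendsto_one_div_add_atTop_nhds_zero_nat (𝕜 := ℝ)
  let F : ℕ → Pt3 → ℝ := fun n x => χ (r n • x) * f x
  have hFd : ∀ n x, HasFDerivAt (F n) (χ (r n • x) • fderiv ℝ f x +
      f x • (fderiv ℝ χ (r n • x)).comp (r n • ContinuousLinearMap.id ℝ Pt3)) x := fun n x => by
    have h1 : HasFDerivAt (fun x => χ (r n • x))
        ((fderiv ℝ χ (r n • x)).comp (r n • ContinuousLinearMap.id ℝ Pt3)) x :=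
      (hχ (r n • x)).hasFDerivAt.comp x ((hasFDerivAt_id x).const_smul (r n))
    exact h1.mul (hf x).hasFDerivAt
  have hFdiff : ∀ n, Differentiable ℝ (F n) := fun n x => (hFd n x).differentiableAt
  have hFc : ∀ n, HasCompactSupport (F n) := fun n => by
    have h1 : HasCompactSupport (fun x : Pt3 => χ (r n • x)) := χ.hasCompactSupport.comp_smul (hr0 n).ne'
    exact h1.mul_right
  have hFgrad : ∀ n x, eGradSq3 (F n) x ≤
      2 * eGradSq3 f x + 6 * ENNReal.ofReal (K * r n) ^ 2 * ‖f x‖ₑ ^ 2 := by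
    intro n x
    have hi : ∀ i : Fin 3, ‖grad3 (F n) x i‖ₑ ^ 2 ≤
        2 * ‖grad3 f x i‖ₑ ^ 2 + 2 * ENNReal.ofReal (K * r n) ^ 2 * ‖f x‖ₑ ^ 2 := by
      intro i
      have e : grad3 (F n) x i = χ (r n • x) * grad3 f x i + f x * (r n * grad3 χ (r n • x) i) := by
        simp [grad3, (hFd n x).fderiv]
      rw [e]
      refine (enorm_add_sq_le _ _).trans (add_le_add ?_ ?_)
      · gcongr
        rw [enorm_mul]
        refine mul_le_of_le_one_left zero_le ?_
        rw [Real.enorm_of_nonneg χ.nonneg]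
        exact ENNReal.ofReal_le_one.mpr χ.le_one
      · rw [mul_assoc, ← mul_pow]
        gcongr
        rw [enorm_mul, mul_comm]
        gcongr
        rw [← ofReal_norm, norm_mul, norm_of_nonneg (hr0 n).le, mul_comm]
        exact ENNReal.ofReal_le_ofReal (mul_le_mul_of_nonneg_right (hK _ _) (hr0 n).le)
    calc eGradSq3 (F n) x ≤ ∑ i, (2 * ‖grad3 f x i‖ₑ ^ 2 +
          2 * ENNReal.ofReal (K * r n) ^ 2 * ‖f x‖ₑ ^ 2) := Finset.sum_le_sum fun i _ => hi i
      _ = _ := by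
        rw [Finset.sum_add_distrib, ← Finset.mul_sum]
        simp only [Finset.sum_const, Finset.card_univ, Fintype.card_fin, nsmul_eq_mul, eGradSq3]
        push_cast
        ring
  set G := ∫⁻ x, eGradSq3 f x
  set L := ∫⁻ x, ‖f x‖ₑ ^ 2
  have hfm : Measurable fun x => ‖f x‖ₑ := hf.continuous.measurable.enorm
  have hbound : ∀ n, ∫⁻ x, ‖F n x‖ₑ ^ 6 ≤
      4096 * (2 * G + 6 * ENNReal.ofReal (K * r n) ^ 2 * L) ^ 3 := by
    intro n
    refine (lintegral_pow_six_le_of_hasCompactSupport (hFdiff n) (hFc n)).trans ?_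
    gcongr
    refine (lintegral_mono (hFgrad n)).trans_eq ?_
    rw [lintegral_add_left ((measurable_eGradSq3 f).const_mul 2),
      lintegral_const_mul' _ _ (by norm_num), lintegral_const_mul _ (hfm.pow_const 2)]
  have hlim : Tendsto (fun n => 4096 * (2 * G + 6 * ENNReal.ofReal (K * r n) ^ 2 * L) ^ 3) atTop
      (nhds (4096 * (2 * G) ^ 3)) := by
    have h3 : Tendsto (fun n => ENNReal.ofReal (K * r n)) atTop (nhds 0) := by
      have := ENNReal.tendsto_ofReal (hrt.const_mul K)
      simpa using this
    have h4 : Tendsto (fun n => 6 * ENNReal.ofReal (K * r n) ^ 2 * L) atTop (nhds 0) := by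
      have := ENNReal.Tendsto.mul_const (ENNReal.Tendsto.const_mul (ENNReal.Tendsto.pow h3 (n := 2))
        (Or.inr (by norm_num : (6 : ENNReal) ≠ ⊤))) (Or.inr h2)
      simpa using this
    have h5 := (tendsto_const_nhds (x := 2 * G)).add h4
    rw [add_zero] at h5
    exact ENNReal.Tendsto.const_mul (ENNReal.Tendsto.pow h5 (n := 3)) (Or.inr (by norm_num))
  have hpt : ∀ x, liminf (fun n => ‖F n x‖ₑ ^ 6) atTop = ‖f x‖ₑ ^ 6 := by
    intro x
    refine Tendsto.liminf_eq ?_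
    have h6 : Tendsto (fun n => χ (r n • x) * f x) atTop (nhds (χ ((0 : ℝ) • x) * f x)) :=
      ((hχ.continuous.tendsto _).comp (hrt.smul_const x)).mul_const _
    have h7 : χ ((0 : ℝ) • x) = 1 := by
      rw [zero_smul]; exact χ.one_of_mem_closedBall (by simp [χ.rIn_pos.le])
    rw [h7, one_mul] at h6
    exact ENNReal.Tendsto.pow ((continuous_enorm.tendsto _).comp h6)
  calc ∫⁻ x, ‖f x‖ₑ ^ 6 = ∫⁻ x, liminf (fun n => ‖F n x‖ₑ ^ 6) atTop := by simp only [hpt]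
    _ ≤ liminf (fun n => ∫⁻ x, ‖F n x‖ₑ ^ 6) atTop :=
        lintegral_liminf_le fun n => (hFdiff n).continuous.measurable.enorm.pow_const 6
    _ ≤ liminf (fun n => 4096 * (2 * G + 6 * ENNReal.ofReal (K * r n) ^ 2 * L) ^ 3) atTop :=
        liminf_le_liminf (Eventually.of_forall hbound)
    _ = 4096 * (2 * G) ^ 3 := hlim.liminf_eq
    _ = _ := by ring

/-- Lebesgue measure on the fundamental domain of the circle. -/
abbrev circ : Measure ℝ := volume.restrict (Set.Ioc 0 (2 * π))

theorem hasFDerivAt_slice {u : Pt → ℝ} (hu : Differentiable ℝ u) (x : Pt3) (y : ℝ) :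
    HasFDerivAt (fun x => u (x, y))
      ((fderiv ℝ u (x, y)).comp (ContinuousLinearMap.inl ℝ Pt3 ℝ)) x :=
  (hu (x, y)).hasFDerivAt.comp x (hasFDerivAt_prodMk_left x y)

theorem grad3_slice {u : Pt → ℝ} (hu : Differentiable ℝ u) (x : Pt3) (y : ℝ) (i : Fin 3) :
    grad3 (fun x => u (x, y)) x i = gradx u (x, y) i := by
  simp only [grad3, gradx, (hasFDerivAt_slice hu x y).fderiv, ContinuousLinearMap.comp_apply,
    ContinuousLinearMap.inl_apply, ex]
  rfl

theorem differentiable_slice {u : Pt → ℝ} (hu : Differentiable ℝ u) (y : ℝ) :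
    Differentiable ℝ (fun x => u (x, y)) := fun x => (hasFDerivAt_slice hu x y).differentiableAt

theorem hasDerivAt_vertical {u : Pt → ℝ} (hu : Differentiable ℝ u) (x : Pt3) (y : ℝ) :
    HasDerivAt (fun y => u (x, y)) (grady u (x, y)) y := by
  have h := (hu (x, y)).hasFDerivAt.comp_hasDerivAt y
    ((hasDerivAt_const y x).prodMk (hasDerivAt_id y))
  exact h

theorem measurable_gradx (u : Pt → ℝ) (i : Fin 3) : Measurable fun p => gradx u p i :=
  measurable_fderiv_apply_const ℝ u (ex i)

theorem measurable_grady (u : Pt → ℝ) : Measurable (grady u) :=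
  measurable_fderiv_apply_const ℝ u ey

/-- The `[0, ∞]`-valued horizontal Dirichlet energy. -/
def eA (f : Pt → ℝ) : ENNReal := ∫⁻ y, ∫⁻ x, ∑ i, ‖gradx f (x, y) i‖ₑ ^ 2 ∂volume ∂circ

/-- The `[0, ∞]`-valued vertical Dirichlet energy. -/
def eB (f : Pt → ℝ) : ENNReal := ∫⁻ y, ∫⁻ x, ‖grady f (x, y)‖ₑ ^ 2 ∂volume ∂circ

/-- The mean oscillation in `y` of the horizontal gradient. -/
def eE (f : Pt → ℝ) : ENNReal :=
  ∫⁻ q, ∫⁻ x, ∑ i, ‖gradx f (x, q.1) i - gradx f (x, q.2) i‖ₑ ^ 2 ∂volume ∂(circ.prod circ)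

theorem lintegral_mul_mul_sq_le {a b c : Pt3 → ENNReal} (ha : Measurable a) (hb : Measurable b)
    (hc : Measurable c) :
    ∫⁻ x, a x * b x * c x ^ 2 ≤ (∫⁻ x, a x ^ 6) ^ ((1 : ℝ) / 6) *
      (∫⁻ x, b x ^ 2) ^ ((1 : ℝ) / 2) * (∫⁻ x, c x ^ 6) ^ ((1 : ℝ) / 3) := by
  have h := ENNReal.lintegral_prod_norm_pow_le (μ := (volume : Measure Pt3)) Finset.univ
    (f := ![fun x => a x ^ 6, fun x => b x ^ 2, fun x => c x ^ 6])
    (p := ![1 / 6, 1 / 2, 1 / 3])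
    (by
      intro i _
      fin_cases i
      · exact (ha.pow_const 6).aemeasurable
      · exact (hb.pow_const 2).aemeasurable
      · exact (hc.pow_const 6).aemeasurable)
    (by simp [Fin.sum_univ_succ]; norm_num)
    (by intro i _; fin_cases i <;> simp)
  have e1 : ∀ t : ENNReal, (t ^ 6) ^ ((1 : ℝ) / 6) = t := fun t => by
    rw [← ENNReal.rpow_natCast, ← ENNReal.rpow_mul]; norm_num
  have e2 : ∀ t : ENNReal, (t ^ 2) ^ ((1 : ℝ) / 2) = t := fun t => by
    rw [← ENNReal.rpow_natCast, ← ENNReal.rpow_mul]; norm_num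
  have e3 : ∀ t : ENNReal, (t ^ 6) ^ ((1 : ℝ) / 3) = t ^ 2 := fun t => by
    rw [← ENNReal.rpow_natCast, ← ENNReal.rpow_mul, ← ENNReal.rpow_natCast]; norm_num
  simpa only [Fin.prod_univ_three, Matrix.cons_val_zero, Matrix.cons_val_one, Matrix.cons_val,
    e1, e2, e3] using h

/-- The interaction of the oscillation in `y` of `f` with the mass density of `g`. -/
theorem lintegral_oscillation_mul_le {f g : Pt → ℝ} (hf : Differentiable ℝ f)
    (hg : Differentiable ℝ g) (hf2 : ∀ᵐ y ∂circ, ∫⁻ x, ‖f (x, y)‖ₑ ^ 2 ≠ ⊤)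
    (hg2 : ∀ᵐ y ∂circ, ∫⁻ x, ‖g (x, y)‖ₑ ^ 2 ≠ ⊤) :
    ∫⁻ x, (∫⁻ q, ‖f (x, q.1) - f (x, q.2)‖ₑ * ‖grady f (x, q.1)‖ₑ ∂(circ.prod circ)) *
        (∫⁻ z, ‖g (x, z)‖ₑ ^ 2 ∂circ) ≤
      32768 ^ ((1 : ℝ) / 2) * (eE f ^ ((1 : ℝ) / 2) *
        (eB f * ENNReal.ofReal (2 * π)) ^ ((1 : ℝ) / 2) * eA g) := by
  have hfm := hf.continuous.measurable
  have hgm := hg.continuous.measurable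
  have hym := measurable_grady f
  have hxm := measurable_gradx f
  have hxg := measurable_gradx g
  set P : ℝ × ℝ → ENNReal := fun q =>
    ∫⁻ x, ∑ i, ‖gradx f (x, q.1) i - gradx f (x, q.2) i‖ₑ ^ 2 with hP
  set R : ℝ → ENNReal := fun y => ∫⁻ x, ‖grady f (x, y)‖ₑ ^ 2 with hR
  set S : ℝ → ENNReal := fun z => ∫⁻ x, ∑ i, ‖gradx g (x, z) i‖ₑ ^ 2 with hS
  have hPm : Measurable P := by
    apply Measurable.lintegral_prod_left'
      (f := fun p : Pt3 × (ℝ × ℝ) => ∑ i, ‖gradx f (p.1, p.2.1) i - gradx f (p.1, p.2.2) i‖ₑ ^ 2)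
    refine Finset.measurable_fun_sum _ fun i _ => ?_
    exact ((((hxm i).comp (by fun_prop : Measurable fun p : Pt3 × (ℝ × ℝ) => (p.1, p.2.1))).sub
      ((hxm i).comp (by fun_prop : Measurable fun p : Pt3 × (ℝ × ℝ) => (p.1, p.2.2)))).enorm).pow_const 2
  have hRm : Measurable R :=
    Measurable.lintegral_prod_left' (f := fun p : Pt => ‖grady f p‖ₑ ^ 2) (hym.enorm.pow_const 2)
  have hSm : Measurable S :=
    Measurable.lintegral_prod_left' (f := fun p : Pt => ∑ i, ‖gradx g p i‖ₑ ^ 2)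
      (Finset.measurable_fun_sum _ fun i _ => (hxg i).enorm.pow_const 2)
  have hsob : ∀ (a : ENNReal) (b : ENNReal), a ≤ 32768 * b ^ 3 →
      a ^ ((1 : ℝ) / 6) ≤ 32768 ^ ((1 : ℝ) / 6) * b ^ ((1 : ℝ) / 2) := by
    intro a b h
    refine (ENNReal.rpow_le_rpow h (by norm_num)).trans_eq ?_
    rw [ENNReal.mul_rpow_of_nonneg _ _ (by norm_num), ← ENNReal.rpow_natCast b,
      ← ENNReal.rpow_mul]
    norm_num
  have hsob' : ∀ (a : ENNReal) (b : ENNReal), a ≤ 32768 * b ^ 3 →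
      a ^ ((1 : ℝ) / 3) ≤ 32768 ^ ((1 : ℝ) / 3) * b := by
    intro a b h
    refine (ENNReal.rpow_le_rpow h (by norm_num)).trans_eq ?_
    rw [ENNReal.mul_rpow_of_nonneg _ _ (by norm_num), ← ENNReal.rpow_natCast b,
      ← ENNReal.rpow_mul]
    norm_num
  have hK : (32768 : ENNReal) ^ ((1 : ℝ) / 6) * 32768 ^ ((1 : ℝ) / 3) = 32768 ^ ((1 : ℝ) / 2) := by
    rw [← ENNReal.rpow_add _ _ (by norm_num) (by norm_num)]; norm_num
  have hm1 : ∀ x, Measurable fun q : ℝ × ℝ => ‖f (x, q.1) - f (x, q.2)‖ₑ * ‖grady f (x, q.1)‖ₑ :=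
    fun x => ((hfm.comp (by fun_prop)).sub (hfm.comp (by fun_prop))).enorm.mul
      (hym.comp (by fun_prop)).enorm
  have hm2 : ∀ x, Measurable fun z : ℝ => ‖g (x, z)‖ₑ ^ 2 :=
    fun x => (hgm.comp (by fun_prop)).enorm.pow_const 2
  have hslice : ∀ᵐ w ∂((circ.prod circ).prod circ),
      ∫⁻ x, ‖f (x, w.1.1) - f (x, w.1.2)‖ₑ * ‖grady f (x, w.1.1)‖ₑ * ‖g (x, w.2)‖ₑ ^ 2 ≤
        32768 ^ ((1 : ℝ) / 2) * ((P w.1 ^ ((1 : ℝ) / 2) * R w.1.1 ^ ((1 : ℝ) / 2)) * S w.2) := by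
    have h1 : ∀ᵐ w ∂((circ.prod circ).prod circ), ∫⁻ x, ‖f (x, w.1.1)‖ₑ ^ 2 ≠ ⊤ :=
      (Measure.quasiMeasurePreserving_fst.comp Measure.quasiMeasurePreserving_fst).ae hf2
    have h2 : ∀ᵐ w ∂((circ.prod circ).prod circ), ∫⁻ x, ‖f (x, w.1.2)‖ₑ ^ 2 ≠ ⊤ :=
      (Measure.quasiMeasurePreserving_snd.comp Measure.quasiMeasurePreserving_fst).ae hf2
    have h3 : ∀ᵐ w ∂((circ.prod circ).prod circ), ∫⁻ x, ‖g (x, w.2)‖ₑ ^ 2 ≠ ⊤ :=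
      Measure.quasiMeasurePreserving_snd.ae hg2
    filter_upwards [h1, h2, h3] with w h1 h2 h3
    have hd1 := differentiable_slice hf w.1.1
    have hd2 := differentiable_slice hf w.1.2
    have hd3 := differentiable_slice hg w.2
    have hL2 : ∫⁻ x, ‖f (x, w.1.1) - f (x, w.1.2)‖ₑ ^ 2 ≠ ⊤ := by
      refine ne_top_of_le_ne_top ?_ (lintegral_mono
        (g := fun x => 2 * ‖f (x, w.1.1)‖ₑ ^ 2 + 2 * ‖f (x, w.1.2)‖ₑ ^ 2) fun x => ?_)
      · rw [lintegral_add_left ((hd1.continuous.measurable.enorm.pow_const 2).const_mul 2),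
          lintegral_const_mul' _ _ (by norm_num), lintegral_const_mul' _ _ (by norm_num)]
        exact ENNReal.add_ne_top.mpr
          ⟨ENNReal.mul_ne_top (by norm_num) h1, ENNReal.mul_ne_top (by norm_num) h2⟩
      · have := enorm_add_sq_le (f (x, w.1.1)) (-f (x, w.1.2))
        rwa [← sub_eq_add_neg, enorm_neg] at this
    have s1 := lintegral_pow_six_le (hd1.sub hd2) hL2
    have s2 := lintegral_pow_six_le hd3 h3
    have g1 : ∀ x, eGradSq3 ((fun x => f (x, w.1.1)) - fun x => f (x, w.1.2)) x =
        ∑ i, ‖gradx f (x, w.1.1) i - gradx f (x, w.1.2) i‖ₑ ^ 2 := fun x => by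
      simp only [eGradSq3, ← grad3_slice hf]
      simp only [grad3, fderiv_sub (hd1 x) (hd2 x), sub_apply]
    have g2 : ∀ x, eGradSq3 (fun x => g (x, w.2)) x = ∑ i, ‖gradx g (x, w.2) i‖ₑ ^ 2 := fun x => by
      simp only [eGradSq3, ← grad3_slice hg]
    simp only [g1, Pi.sub_apply] at s1
    simp only [g2] at s2
    refine (lintegral_mul_mul_sq_le (hd1.sub hd2).continuous.measurable.enorm
      (hym.comp (by fun_prop : Measurable fun x : Pt3 => (x, w.1.1))).enorm
      hd3.continuous.measurable.enorm).trans ?_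
    simp only [Pi.sub_apply, Function.comp_apply]
    calc _ ≤ (32768 ^ ((1 : ℝ) / 6) * P w.1 ^ ((1 : ℝ) / 2)) * R w.1.1 ^ ((1 : ℝ) / 2) *
          (32768 ^ ((1 : ℝ) / 3) * S w.2) :=
          mul_le_mul' (mul_le_mul' (hsob _ _ s1) le_rfl) (hsob' _ _ s2)
      _ = _ := by rw [← hK]; ring
  have hCS : ∫⁻ q, P q ^ ((1 : ℝ) / 2) * R q.1 ^ ((1 : ℝ) / 2) ∂(circ.prod circ) ≤
      eE f ^ ((1 : ℝ) / 2) * (eB f * ENNReal.ofReal (2 * π)) ^ ((1 : ℝ) / 2) := by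
    have hh := ENNReal.lintegral_mul_le_Lp_mul_Lq (circ.prod circ) Real.HolderConjugate.two_two
      (hPm.pow_const ((1 : ℝ) / 2)).aemeasurable
      ((hRm.comp measurable_fst).pow_const ((1 : ℝ) / 2)).aemeasurable
    have e : ∀ t : ENNReal, (t ^ ((1 : ℝ) / 2)) ^ (2 : ℝ) = t := fun t => by
      rw [← ENNReal.rpow_mul]; norm_num
    simp only [e, Pi.mul_apply, Function.comp_apply] at hh
    refine hh.trans_eq ?_
    congr 2
    rw [lintegral_prod (fun a : ℝ × ℝ => R a.1) (hRm.comp measurable_fst).aemeasurable]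
    simp only [lintegral_const]
    rw [lintegral_mul_const _ hRm]
    simp [eB, hR]
  calc _ = ∫⁻ x, ∫⁻ w, ‖f (x, w.1.1) - f (x, w.1.2)‖ₑ * ‖grady f (x, w.1.1)‖ₑ * ‖g (x, w.2)‖ₑ ^ 2
          ∂((circ.prod circ).prod circ) := by
        refine lintegral_congr fun x => ?_
        rw [lintegral_prod_mul (hm1 x).aemeasurable (hm2 x).aemeasurable]
    _ = ∫⁻ w, ∫⁻ x, ‖f (x, w.1.1) - f (x, w.1.2)‖ₑ * ‖grady f (x, w.1.1)‖ₑ * ‖g (x, w.2)‖ₑ ^ 2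
          ∂volume ∂((circ.prod circ).prod circ) := by
        rw [lintegral_lintegral_swap]
        refine Measurable.aemeasurable ?_
        exact (((hfm.comp (by fun_prop : Measurable fun p : Pt3 × ((ℝ × ℝ) × ℝ) => (p.1, p.2.1.1))).sub
          (hfm.comp (by fun_prop : Measurable fun p : Pt3 × ((ℝ × ℝ) × ℝ) => (p.1, p.2.1.2)))).enorm.mul
          (hym.comp (by fun_prop : Measurable fun p : Pt3 × ((ℝ × ℝ) × ℝ) => (p.1, p.2.1.1))).enorm).mul
          ((hgm.comp (by fun_prop : Measurable fun p : Pt3 × ((ℝ × ℝ) × ℝ) => (p.1, p.2.2))).enorm.pow_const 2)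
    _ ≤ ∫⁻ w, 32768 ^ ((1 : ℝ) / 2) * ((P w.1 ^ ((1 : ℝ) / 2) * R w.1.1 ^ ((1 : ℝ) / 2)) * S w.2)
          ∂((circ.prod circ).prod circ) := lintegral_mono_ae hslice
    _ = 32768 ^ ((1 : ℝ) / 2) * ((∫⁻ q, P q ^ ((1 : ℝ) / 2) * R q.1 ^ ((1 : ℝ) / 2) ∂(circ.prod circ)) *
          ∫⁻ z, S z ∂circ) := by
        rw [lintegral_const_mul' _ _ (by finiteness), lintegral_prod_mul
          (f := fun q : ℝ × ℝ => P q ^ ((1 : ℝ) / 2) * R q.1 ^ ((1 : ℝ) / 2)) ((hPm.pow_const _).mul ((hRm.comp measurable_fst).pow_const _)).aemeasurable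
          hSm.aemeasurable]
    _ ≤ _ := by gcongr; exact le_rfl

theorem circ_univ : circ Set.univ = ENNReal.ofReal (2 * π) := by simp

theorem circ_real_univ : circ.real Set.univ = 2 * π := by
  rw [Measure.real, circ_univ, ENNReal.toReal_ofReal two_pi_pos.le]

theorem integrable_circ {h : ℝ → ℝ} (hh : Continuous h) : Integrable h circ :=
  (hh.integrableOn_Icc (a := 0) (b := 2 * π)).mono_set Set.Ioc_subset_Icc_self

/-- The mean of a function over the circle. -/
def mean (h : ℝ → ℝ) : ℝ := (2 * π)⁻¹ * ∫ y, h y ∂circ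

theorem two_pi_mul_mean (h : ℝ → ℝ) : 2 * π * mean h = ∫ y, h y ∂circ := by
  rw [mean, ← mul_assoc, mul_inv_cancel₀ two_pi_pos.ne', one_mul]

theorem integral_sub_mean {h : ℝ → ℝ} (hh : Integrable h circ) : ∫ y, (h y - mean h) ∂circ = 0 := by
  rw [integral_sub hh (integrable_const _), integral_const, circ_real_univ, smul_eq_mul,
    two_pi_mul_mean, sub_self]

theorem integral_sq_eq {h : ℝ → ℝ} (hh : Integrable h circ)
    (h2 : Integrable (fun y => h y ^ 2) circ) :
    ∫ y, h y ^ 2 ∂circ = 2 * π * mean h ^ 2 + ∫ y, (h y - mean h) ^ 2 ∂circ := by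
  have e : ∀ y, (h y - mean h) ^ 2 = h y ^ 2 - (2 * mean h) * h y + mean h ^ 2 := fun y => by ring
  simp only [e]
  have h3 : Integrable (fun y => h y ^ 2 - (2 * mean h) * h y) circ := h2.sub (hh.const_mul _)
  rw [integral_add h3 (integrable_const _), integral_sub h2 (hh.const_mul _),
    integral_const_mul, integral_const, circ_real_univ, smul_eq_mul, ← two_pi_mul_mean h]
  ring

theorem two_pi_mul_mean_sq_le {h : ℝ → ℝ} (hh : Integrable h circ)
    (h2 : Integrable (fun y => h y ^ 2) circ) :
    2 * π * mean h ^ 2 ≤ ∫ y, h y ^ 2 ∂circ := by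
  rw [integral_sq_eq hh h2]
  have : 0 ≤ ∫ y, (h y - mean h) ^ 2 ∂circ := integral_nonneg fun y => sq_nonneg _
  linarith

theorem exists_eq_mean {h : ℝ → ℝ} (hh : Continuous h) :
    ∃ s ∈ Set.Icc 0 (2 * π), h s = mean h := by
  obtain ⟨s, hs, e⟩ := exists_eq_interval_average (f := h) (a := 0) (b := 2 * π)
    two_pi_pos.ne hh.continuousOn
  refine ⟨s, ?_, ?_⟩
  · rw [Set.uIoo_of_le two_pi_pos.le] at hs
    exact Set.Ioo_subset_Icc_self hs
  · rw [e, interval_average_eq, mean, intervalIntegral.integral_of_le two_pi_pos.le]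
    simp

theorem enorm_sub_le_circ {g : ℝ → ℝ} (hg : Differentiable ℝ g) {a b : ℝ}
    (ha : a ∈ Set.Icc 0 (2 * π)) (hb : b ∈ Set.Icc 0 (2 * π)) :
    ‖g b - g a‖ₑ ≤ ∫⁻ t, ‖deriv g t‖ₑ ∂circ := by
  refine (enorm_sub_le_lintegral_deriv hg a b).trans (lintegral_mono_set ?_)
  exact Set.Ioc_subset_Ioc (le_min ha.1 hb.1) (max_le ha.2 hb.2)

theorem enorm_sub_mean_le {h : ℝ → ℝ} (hh : Continuous h) (y : ℝ) :
    ‖h y - mean h‖ₑ ≤ ENNReal.ofReal (2 * π)⁻¹ * ∫⁻ s, ‖h y - h s‖ₑ ∂circ := by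
  have e : h y - mean h = (2 * π)⁻¹ * ∫ s, (h y - h s) ∂circ := by
    rw [integral_sub (integrable_const _) (integrable_circ hh), integral_const, circ_real_univ,
      mean, smul_eq_mul]
    field_simp
  rw [e, enorm_mul, Real.enorm_of_nonneg (by positivity)]
  gcongr
  exact enorm_integral_le_lintegral_enorm _

/-- The weighted oscillation controlling the deviation of `h` from its mean. -/
def osc (h : ℝ → ℝ) : ENNReal := ∫⁻ q, ‖h q.1 - h q.2‖ₑ * ‖deriv h q.1‖ₑ ∂(circ.prod circ)

theorem enorm_sub_mean_sq_le_osc {h : ℝ → ℝ} (hh : Differentiable ℝ h) {y : ℝ}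
    (hy : y ∈ Set.Icc 0 (2 * π)) : ‖h y - mean h‖ₑ ^ 2 ≤ ENNReal.ofReal π⁻¹ * osc h := by
  obtain ⟨s, hs, e⟩ := exists_eq_mean hh.continuous
  have hd : ∀ t, HasDerivAt (fun t => (h t - mean h) ^ 2) (2 * (h t - mean h) * deriv h t) t :=
    fun t => by simpa using ((hh t).hasDerivAt.sub_const (mean h)).fun_pow 2
  have h1 := enorm_sub_le_circ (fun t => (hd t).differentiableAt) hs hy
  have h2 : ‖h y - mean h‖ₑ ^ 2 ≤ ∫⁻ t, 2 * (‖h t - mean h‖ₑ * ‖deriv h t‖ₑ) ∂circ := by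
    refine le_trans (by simp [e]) (h1.trans_eq (lintegral_congr fun t => ?_))
    rw [(hd t).deriv, enorm_mul, enorm_mul, mul_assoc]
    congr 1
    rw [← ofReal_norm]; simp
  have hm : Measurable h := hh.continuous.measurable
  have hdm := measurable_deriv h
  refine h2.trans ?_
  rw [osc, lintegral_prod (fun q : ℝ × ℝ => ‖h q.1 - h q.2‖ₑ * ‖deriv h q.1‖ₑ)
    (((hm.comp measurable_fst).sub (hm.comp measurable_snd)).enorm.mul
      (hdm.comp measurable_fst).enorm).aemeasurable,
    ← lintegral_const_mul' _ _ ENNReal.ofReal_ne_top]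
  refine lintegral_mono fun t => ?_
  have hm3 : Measurable fun s => ‖h t - h s‖ₑ := (measurable_const.sub hm).enorm
  simp only
  rw [lintegral_mul_const _ hm3]
  have h3 := enorm_sub_mean_le hh.continuous t
  have h4 : ENNReal.ofReal π⁻¹ = 2 * ENNReal.ofReal (2 * π)⁻¹ := by
    rw [← ENNReal.ofReal_ofNat, ← ENNReal.ofReal_mul (by norm_num)]
    congr 1; field_simp
  calc 2 * (‖h t - mean h‖ₑ * ‖deriv h t‖ₑ)
      ≤ 2 * ((ENNReal.ofReal (2 * π)⁻¹ * ∫⁻ s, ‖h t - h s‖ₑ ∂circ) * ‖deriv h t‖ₑ) := by gcongr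
    _ = _ := by rw [h4]; ring

theorem enorm_sub_mean_sq_le {h : ℝ → ℝ} (hh : Differentiable ℝ h) {y : ℝ}
    (hy : y ∈ Set.Icc 0 (2 * π)) :
    ‖h y - mean h‖ₑ ^ 2 ≤ ENNReal.ofReal (2 * π) * ∫⁻ t, ‖deriv h t‖ₑ ^ 2 ∂circ := by
  obtain ⟨s, hs, e⟩ := exists_eq_mean hh.continuous
  have h1 := enorm_sub_le_circ hh hs hy
  rw [e] at h1
  have h2 := ENNReal.lintegral_mul_le_Lp_mul_Lq circ Real.HolderConjugate.two_two
    (measurable_const (a := (1 : ENNReal))).aemeasurable (measurable_deriv h).enorm.aemeasurable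
  simp only [Pi.mul_apply, one_mul, ENNReal.rpow_two, one_pow, lintegral_one, circ_univ] at h2
  calc ‖h y - mean h‖ₑ ^ 2 ≤ (ENNReal.ofReal (2 * π) ^ ((1 : ℝ) / 2) *
        (∫⁻ t, ‖deriv h t‖ₑ ^ 2 ∂circ) ^ ((1 : ℝ) / 2)) ^ 2 := by
        gcongr; exact h1.trans h2
    _ = _ := by
        rw [mul_pow]
        simp only [← ENNReal.rpow_natCast, ← ENNReal.rpow_mul]; norm_num

theorem ofReal_integral_sq {h : ℝ → ℝ} (hh : Continuous h) :
    ENNReal.ofReal (∫ y, h y ^ 2 ∂circ) = ∫⁻ y, ‖h y‖ₑ ^ 2 ∂circ := by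
  rw [ofReal_integral_eq_lintegral_ofReal (integrable_circ (h := fun y => h y ^ 2) (by fun_prop))
    (Eventually.of_forall fun y => sq_nonneg _)]
  refine lintegral_congr fun y => ?_
  rw [← enorm_pow, Real.enorm_of_nonneg (sq_nonneg _)]

theorem lintegral_sq_le_mean {h : ℝ → ℝ} (hh : Differentiable ℝ h) :
    ∫⁻ y, ‖h y‖ₑ ^ 2 ∂circ ≤ ENNReal.ofReal (2 * π) * ‖mean h‖ₑ ^ 2 +
      ENNReal.ofReal (4 * π ^ 2) * ∫⁻ t, ‖deriv h t‖ₑ ^ 2 ∂circ := by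
  have hc := hh.continuous
  rw [← ofReal_integral_sq hc, integral_sq_eq (integrable_circ hc) (integrable_circ (hc.pow 2)),
    ENNReal.ofReal_add (by positivity) (integral_nonneg fun y => sq_nonneg _),
    ENNReal.ofReal_mul two_pi_pos.le, ← Real.enorm_of_nonneg (sq_nonneg (mean h)), enorm_pow]
  gcongr
  rw [ofReal_integral_sq (h := fun y => h y - mean h) (by fun_prop)]
  calc ∫⁻ y, ‖h y - mean h‖ₑ ^ 2 ∂circ
      ≤ ∫⁻ _, ENNReal.ofReal (2 * π) * ∫⁻ t, ‖deriv h t‖ₑ ^ 2 ∂circ ∂circ :=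
        setLIntegral_mono measurable_const fun y hy =>
          enorm_sub_mean_sq_le hh (Set.Ioc_subset_Icc_self hy)
    _ = _ := by
        rw [lintegral_const, circ_univ, mul_right_comm, ← ENNReal.ofReal_mul two_pi_pos.le]
        congr 2; ring

theorem quartic_le (H K h k : ℝ) :
    (h ^ 2 + k ^ 2) ^ 2 ≤ (H ^ 2 + K ^ 2) ^ 2 +
      4 * (H ^ 2 + K ^ 2) * (H * (h - H) + K * (k - K)) +
      ((h - H) ^ 2 + (k - K) ^ 2) * (14 * (H ^ 2 + K ^ 2) + 6 * (h ^ 2 + k ^ 2)) := by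
  obtain ⟨a, rfl⟩ : ∃ a, h = H + a := ⟨h - H, by ring⟩
  obtain ⟨b, rfl⟩ : ∃ b, k = K + b := ⟨k - K, by ring⟩
  have h1 : (H * a + K * b) ^ 2 ≤ (H ^ 2 + K ^ 2) * (a ^ 2 + b ^ 2) := by
    nlinarith [sq_nonneg (H * b - K * a)]
  have h2 : 0 ≤ (a ^ 2 + b ^ 2) * ((2 * H + a) ^ 2 + (2 * K + b) ^ 2) := by positivity
  have h3 : 0 ≤ (a ^ 2 + b ^ 2) * (H ^ 2 + K ^ 2) := by positivity
  have h4 : 0 ≤ (a ^ 2 + b ^ 2) * (a ^ 2 + b ^ 2) := by positivity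
  have h5 : 0 ≤ (a ^ 2 + b ^ 2) * ((H + a) ^ 2 + (K + b) ^ 2) := by positivity
  nlinarith

theorem integral_quartic_le {h k : ℝ → ℝ} (hh : Continuous h) (hk : Continuous k) {W : ℝ}
    (hW : ∀ y ∈ Set.Icc 0 (2 * π), (h y - mean h) ^ 2 + (k y - mean k) ^ 2 ≤ W) :
    ∫ y, (h y ^ 2 + k y ^ 2) ^ 2 ∂circ ≤ 2 * π * (mean h ^ 2 + mean k ^ 2) ^ 2 +
      20 * W * ∫ y, (h y ^ 2 + k y ^ 2) ∂circ := by
  set H := mean h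
  set K := mean k
  have hW0 : 0 ≤ W := le_trans (by positivity) (hW 0 ⟨le_rfl, two_pi_pos.le⟩)
  have hi := integrable_circ hh
  have ki := integrable_circ hk
  have hi2 : Integrable (fun y => h y ^ 2) circ := integrable_circ (by fun_prop)
  have ki2 : Integrable (fun y => k y ^ 2) circ := integrable_circ (by fun_prop)
  have e1 : ∫ y, (H * (h y - H) + K * (k y - K)) ∂circ = 0 := by
    rw [integral_add (integrable_circ (by fun_prop)) (integrable_circ (by fun_prop)),
      integral_const_mul, integral_const_mul, integral_sub_mean hi, integral_sub_mean ki]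
    ring
  have e2 : Integrable (fun y => ((H ^ 2 + K ^ 2) ^ 2 + W * (14 * (H ^ 2 + K ^ 2))) +
        4 * (H ^ 2 + K ^ 2) * (H * (h y - H) + K * (k y - K))) circ :=
    integrable_circ (by fun_prop)
  have e3 : Integrable (fun y => 4 * (H ^ 2 + K ^ 2) * (H * (h y - H) + K * (k y - K))) circ :=
    integrable_circ (by fun_prop)
  calc ∫ y, (h y ^ 2 + k y ^ 2) ^ 2 ∂circ
      ≤ ∫ y, (((H ^ 2 + K ^ 2) ^ 2 + W * (14 * (H ^ 2 + K ^ 2))) +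
        4 * (H ^ 2 + K ^ 2) * (H * (h y - H) + K * (k y - K)) +
        6 * W * (h y ^ 2 + k y ^ 2)) ∂circ := by
        refine setIntegral_mono_on (integrable_circ (by fun_prop)) (integrable_circ (by fun_prop))
          measurableSet_Ioc fun y hy => ?_
        have h1 := quartic_le H K (h y) (k y)
        have h2 := mul_le_mul_of_nonneg_right (hW y (Set.Ioc_subset_Icc_self hy))
          (by positivity : 0 ≤ 14 * (H ^ 2 + K ^ 2) + 6 * (h y ^ 2 + k y ^ 2))
        linarith
    _ = 2 * π * ((H ^ 2 + K ^ 2) ^ 2 + W * (14 * (H ^ 2 + K ^ 2))) +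
        6 * W * ∫ y, (h y ^ 2 + k y ^ 2) ∂circ := by
        rw [integral_add e2 (integrable_circ (by fun_prop)),
          integral_add (integrable_const _) e3, integral_const_mul, integral_const_mul, e1,
          integral_const, circ_real_univ, smul_eq_mul]
        ring
    _ ≤ _ := by
        have h3 : 2 * π * (H ^ 2 + K ^ 2) ≤ ∫ y, (h y ^ 2 + k y ^ 2) ∂circ := by
          rw [integral_add hi2 ki2, mul_add]
          exact add_le_add (two_pi_mul_mean_sq_le hi hi2) (two_pi_mul_mean_sq_le ki ki2)
        nlinarith [mul_le_mul_of_nonneg_left h3 hW0]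

theorem ofReal_integral_quartic_le {h k : ℝ → ℝ} (hh : Differentiable ℝ h)
    (hk : Differentiable ℝ k) :
    ENNReal.ofReal (∫ y, (h y ^ 2 + k y ^ 2) ^ 2 ∂circ) ≤
      ENNReal.ofReal (2 * π * (mean h ^ 2 + mean k ^ 2) ^ 2) +
      20 * (ENNReal.ofReal π⁻¹ * (osc h + osc k)) *
        (∫⁻ y, ‖h y‖ₑ ^ 2 ∂circ + ∫⁻ y, ‖k y‖ₑ ^ 2 ∂circ) := by
  have hc := hh.continuous
  have kc := hk.continuous
  obtain ⟨s, hs, hmax⟩ := isCompact_Icc.exists_isMaxOn (Set.nonempty_Icc.mpr two_pi_pos.le)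
    (by fun_prop : ContinuousOn (fun y => (h y - mean h) ^ 2 + (k y - mean k) ^ 2)
      (Set.Icc 0 (2 * π)))
  have h1 := integral_quartic_le hc kc (fun y hy => hmax hy)
  refine (ENNReal.ofReal_le_ofReal h1).trans ?_
  rw [ENNReal.ofReal_add (by positivity) (mul_nonneg (mul_nonneg (by norm_num) (by positivity))
    (integral_nonneg fun y => by positivity)), ENNReal.ofReal_mul (by positivity),
    integral_add (integrable_circ (by fun_prop)) (integrable_circ (by fun_prop)),
    ENNReal.ofReal_mul (mul_nonneg (by norm_num) (by positivity)),
    ENNReal.ofReal_add (integral_nonneg fun y => sq_nonneg _)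
      (integral_nonneg fun y => sq_nonneg _), ofReal_integral_sq hc, ofReal_integral_sq kc,
    ENNReal.ofReal_mul (p := 20) (by norm_num), ENNReal.ofReal_ofNat,
    ENNReal.ofReal_add (sq_nonneg _) (sq_nonneg _),
    ← Real.enorm_of_nonneg (sq_nonneg (h s - mean h)),
    ← Real.enorm_of_nonneg (sq_nonneg (k s - mean k)), enorm_pow, enorm_pow,
    mul_add (ENNReal.ofReal π⁻¹)]
  gcongr
  · exact enorm_sub_mean_sq_le_osc hh hs
  · exact enorm_sub_mean_sq_le_osc hk hs

/-- The `y`-average of a function on the waveguide. -/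
def avg (u : Pt → ℝ) (x : Pt3) : ℝ := mean fun y => u (x, y)

/-- The `y`-average of the horizontal gradient. -/
def avgGrad (u : Pt → ℝ) (x : Pt3) (i : Fin 3) : ℝ := mean fun y => gradx u (x, y) i

theorem restrict_dom : (volume : Measure Pt).restrict Dom = (volume : Measure Pt3).prod circ := by
  rw [Dom, Measure.volume_eq_prod, ← Measure.prod_restrict, Measure.restrict_univ]

theorem ofReal_integral_dom {F : Pt → ℝ} (hm : Measurable F) (hi : IntegrableOn F Dom)
    (h0 : ∀ p, 0 ≤ F p) :
    ENNReal.ofReal (∫ p in Dom, F p) = ∫⁻ x, ∫⁻ y, ENNReal.ofReal (F (x, y)) ∂circ ∂volume := by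
  rw [ofReal_integral_eq_lintegral_ofReal hi (Eventually.of_forall h0), restrict_dom,
    lintegral_prod _ hm.ennreal_ofReal.aemeasurable]

theorem ofReal_sq_eq (t : ℝ) : ENNReal.ofReal (t ^ 2) = ‖t‖ₑ ^ 2 := by
  rw [← enorm_pow, Real.enorm_of_nonneg (sq_nonneg _)]

theorem measurable_gradSqX (u : Pt → ℝ) : Measurable (gradSqX u) :=
  Finset.measurable_fun_sum _ fun i _ => (measurable_gradx u i).pow_const 2

theorem gradSqX_nonneg (u : Pt → ℝ) (p : Pt) : 0 ≤ gradSqX u p :=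
  Finset.sum_nonneg fun _ _ => sq_nonneg _

theorem H1.integrable_gradSqX {u : Pt → ℝ} (hu : H1 u) : IntegrableOn (gradSqX u) Dom := by
  refine hu.memGrad.mono' (measurable_gradSqX u).aestronglyMeasurable
    (Eventually.of_forall fun p => ?_)
  rw [Real.norm_of_nonneg (gradSqX_nonneg u p), gradSq]
  linarith [sq_nonneg (grady u p)]

theorem H1.integrable_grady_sq {u : Pt → ℝ} (hu : H1 u) :
    IntegrableOn (fun p => grady u p ^ 2) Dom := by
  refine hu.memGrad.mono' ((measurable_grady u).pow_const 2).aestronglyMeasurable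
    (Eventually.of_forall fun p => ?_)
  rw [Real.norm_of_nonneg (sq_nonneg _), gradSq]
  linarith [gradSqX_nonneg u p]

theorem H1.eA_eq {u : Pt → ℝ} (hu : H1 u) : eA u = ENNReal.ofReal (∫ p in Dom, gradSqX u p) := by
  rw [ofReal_integral_dom (measurable_gradSqX u) hu.integrable_gradSqX (gradSqX_nonneg u),
    eA, lintegral_lintegral_swap]
  · simp_rw [gradSqX, ENNReal.ofReal_sum_of_nonneg fun i _ => sq_nonneg _, ofReal_sq_eq]
  · have : Measurable fun p : ℝ × Pt3 => ∑ i, ‖gradx u (p.2, p.1) i‖ₑ ^ 2 :=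
      Finset.measurable_fun_sum _ fun i _ =>
        ((measurable_gradx u i).comp measurable_swap).enorm.pow_const 2
    exact this.aemeasurable

theorem H1.eB_eq {u : Pt → ℝ} (hu : H1 u) : eB u = ENNReal.ofReal (∫ p in Dom, grady u p ^ 2) := by
  rw [ofReal_integral_dom ((measurable_grady u).pow_const 2) hu.integrable_grady_sq
    fun p => sq_nonneg _, eB, lintegral_lintegral_swap]
  · simp_rw [ofReal_sq_eq]
  · have : Measurable fun p : ℝ × Pt3 => ‖grady u (p.2, p.1)‖ₑ ^ 2 :=
      ((measurable_grady u).comp measurable_swap).enorm.pow_const 2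
    exact this.aemeasurable

theorem H1.mass_eq {u : Pt → ℝ} (hu : H1 u) :
    ENNReal.ofReal (∫ p in Dom, u p ^ 2) = ∫⁻ x, ∫⁻ y, ‖u (x, y)‖ₑ ^ 2 ∂circ ∂volume := by
  rw [ofReal_integral_dom (hu.diff.continuous.measurable.pow_const 2) hu.memL2
    fun p => sq_nonneg _]
  simp_rw [ofReal_sq_eq]

theorem H1.slice_mass_ne_top {u : Pt → ℝ} (hu : H1 u) :
    ∀ᵐ y ∂circ, ∫⁻ x, ‖u (x, y)‖ₑ ^ 2 ≠ ⊤ := by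
  have hm : Measurable fun p : Pt => ‖u p‖ₑ ^ 2 := hu.diff.continuous.measurable.enorm.pow_const 2
  have h := hu.mass_eq
  rw [lintegral_lintegral_swap (f := fun x y => ‖u (x, y)‖ₑ ^ 2) hm.aemeasurable] at h
  have h2 := ae_lt_top (μ := circ) (f := fun y => ∫⁻ x, ‖u (x, y)‖ₑ ^ 2) hm.lintegral_prod_left'
    (h ▸ ENNReal.ofReal_ne_top)
  exact h2.mono fun y hy => hy.ne

theorem deriv_vertical {u : Pt → ℝ} (hu : Differentiable ℝ u) (x : Pt3) (y : ℝ) :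
    deriv (fun y => u (x, y)) y = grady u (x, y) := (hasDerivAt_vertical hu x y).deriv

theorem differentiable_vertical {u : Pt → ℝ} (hu : Differentiable ℝ u) (x : Pt3) :
    Differentiable ℝ fun y => u (x, y) := fun y => (hasDerivAt_vertical hu x y).differentiableAt

theorem continuous_avg {u : Pt → ℝ} (hu : Continuous u) : Continuous (avg u) := by
  have : Continuous fun x => ∫ y in (0 : ℝ)..(2 * π), u (x, y) :=
    intervalIntegral.continuous_parametric_intervalIntegral_of_continuous' (f := fun x y => u (x, y))
      (by simpa [Function.uncurry_def] using hu) 0 (2 * π)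
  simp only [intervalIntegral.integral_of_le two_pi_pos.le] at this
  exact continuous_const.mul this

theorem measurable_avgGrad (u : Pt → ℝ) (i : Fin 3) : Measurable fun x => avgGrad u x i := by
  have : StronglyMeasurable fun x : Pt3 => ∫ y, gradx u (x, y) i ∂circ :=
    StronglyMeasurable.integral_prod_right' (f := fun p : Pt => gradx u p i)
      (measurable_gradx u i).stronglyMeasurable
  exact this.measurable.const_mul _

theorem H1.mass_le {u : Pt → ℝ} (hu : H1 u) :
    ∫⁻ x, ∫⁻ y, ‖u (x, y)‖ₑ ^ 2 ∂circ ∂volume ≤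
      ENNReal.ofReal (2 * π) * (∫⁻ x, ‖avg u x‖ₑ ^ 2) + ENNReal.ofReal (4 * π ^ 2) * eB u := by
  have hm := (continuous_avg hu.diff.continuous).measurable.enorm.pow_const 2
  have h : eB u = ∫⁻ x, ∫⁻ y, ‖grady u (x, y)‖ₑ ^ 2 ∂circ ∂volume := by
    rw [eB, lintegral_lintegral_swap]
    have : Measurable fun p : ℝ × Pt3 => ‖grady u (p.2, p.1)‖ₑ ^ 2 :=
      ((measurable_grady u).comp measurable_swap).enorm.pow_const 2
    exact this.aemeasurable
  rw [h, ← lintegral_const_mul' _ _ ENNReal.ofReal_ne_top,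
    ← lintegral_const_mul' _ _ ENNReal.ofReal_ne_top, ← lintegral_add_left (hm.const_mul _)]
  refine lintegral_mono fun x => ?_
  have := lintegral_sq_le_mean (differentiable_vertical hu.diff x)
  simp only [deriv_vertical hu.diff] at this
  exact this

/-- The interaction term `∫ osc(f) |g|²`. -/
def inter (f g : Pt → ℝ) : ENNReal :=
  ∫⁻ x, osc (fun y => f (x, y)) * ∫⁻ z, ‖g (x, z)‖ₑ ^ 2 ∂circ

theorem H1.inter_le {f g : Pt → ℝ} (hf : H1 f) (hg : H1 g) :
    inter f g ≤ 32768 ^ ((1 : ℝ) / 2) * (eE f ^ ((1 : ℝ) / 2) *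
        (eB f * ENNReal.ofReal (2 * π)) ^ ((1 : ℝ) / 2) * eA g) := by
  have := lintegral_oscillation_mul_le hf.diff hg.diff hf.slice_mass_ne_top hg.slice_mass_ne_top
  simpa only [inter, osc, deriv_vertical hf.diff] using this

theorem measurable_osc_vertical {u : Pt → ℝ} (hu : Differentiable ℝ u) :
    Measurable fun x => osc fun y => u (x, y) := by
  simp only [osc, deriv_vertical hu]
  have hm := hu.continuous.measurable
  refine Measurable.lintegral_prod_right' (f := fun p : Pt3 × (ℝ × ℝ) =>
    ‖u (p.1, p.2.1) - u (p.1, p.2.2)‖ₑ * ‖grady u (p.1, p.2.1)‖ₑ) ?_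
  exact ((hm.comp (by fun_prop)).sub (hm.comp (by fun_prop))).enorm.mul
    ((measurable_grady u).comp (by fun_prop)).enorm

theorem nonlin_eq (u v : Pt → ℝ) (p : Pt) : nonlin u v p = (u p ^ 2 + v p ^ 2) ^ 2 := by
  rw [nonlin]; ring

theorem nonlin_nonneg (u v : Pt → ℝ) (p : Pt) : 0 ≤ nonlin u v p := by
  rw [nonlin_eq]; positivity

theorem H1.integrable_nonlin {u v : Pt → ℝ} (hu : H1 u) (hv : H1 v) :
    IntegrableOn (nonlin u v) Dom := by
  have hm : Measurable (nonlin u v) := by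
    have := hu.diff.continuous.measurable
    have := hv.diff.continuous.measurable
    unfold nonlin; fun_prop
  refine ((hu.memL4.const_mul 2).add (hv.memL4.const_mul 2)).mono' hm.aestronglyMeasurable
    (Eventually.of_forall fun p => ?_)
  rw [Real.norm_of_nonneg (nonlin_nonneg u v p), nonlin]
  simp only [Pi.add_apply]
  nlinarith [sq_nonneg (u p ^ 2 - v p ^ 2)]

theorem H1.nonlin_le {u v : Pt → ℝ} (hu : H1 u) (hv : H1 v) :
    ENNReal.ofReal (∫ p in Dom, nonlin u v p) ≤
      (∫⁻ x, ENNReal.ofReal (2 * π * (avg u x ^ 2 + avg v x ^ 2) ^ 2)) +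
      20 * ENNReal.ofReal π⁻¹ * ((inter u u + inter v u) + (inter u v + inter v v)) := by
  have huc := hu.diff.continuous
  have hvc := hv.diff.continuous
  have hm : Measurable (nonlin u v) := by
    have := huc.measurable
    have := hvc.measurable
    unfold nonlin; fun_prop
  have hau := continuous_avg huc
  have hav := continuous_avg hvc
  have hou := measurable_osc_vertical hu.diff
  have hov := measurable_osc_vertical hv.diff
  have hmu : Measurable fun x => ∫⁻ z, ‖u (x, z)‖ₑ ^ 2 ∂circ :=
    Measurable.lintegral_prod_right' (f := fun p : Pt => ‖u p‖ₑ ^ 2)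
      (huc.measurable.enorm.pow_const 2)
  have hm1 : Measurable fun x => osc (fun y => u (x, y)) * ∫⁻ z, ‖u (x, z)‖ₑ ^ 2 ∂circ :=
    hou.mul hmu
  have hmv : Measurable fun x => ∫⁻ z, ‖v (x, z)‖ₑ ^ 2 ∂circ :=
    Measurable.lintegral_prod_right' (f := fun p : Pt => ‖v p‖ₑ ^ 2)
      (hvc.measurable.enorm.pow_const 2)
  have hm3 : Measurable fun x => osc (fun y => u (x, y)) * ∫⁻ z, ‖v (x, z)‖ₑ ^ 2 ∂circ :=
    hou.mul hmv
  have hm4 : Measurable fun x => osc (fun y => v (x, y)) * ∫⁻ z, ‖u (x, z)‖ₑ ^ 2 ∂circ :=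
    hov.mul hmu
  have hm14 : Measurable fun x => osc (fun y => u (x, y)) * (∫⁻ z, ‖u (x, z)‖ₑ ^ 2 ∂circ) +
      osc (fun y => v (x, y)) * ∫⁻ z, ‖u (x, z)‖ₑ ^ 2 ∂circ := hm1.add hm4
  have hc : (20 * ENNReal.ofReal π⁻¹ : ENNReal) ≠ ⊤ := by finiteness
  rw [ofReal_integral_dom hm (hu.integrable_nonlin hv) (nonlin_nonneg u v)]
  simp only [inter]
  rw [← lintegral_add_left hm1, ← lintegral_add_left hm3,
    ← lintegral_add_left hm14, ← lintegral_const_mul' _ _ hc,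
    ← lintegral_add_left (by fun_prop)]
  refine lintegral_mono fun x => ?_
  have h := ofReal_integral_quartic_le (differentiable_vertical hu.diff x)
    (differentiable_vertical hv.diff x)
  rw [ofReal_integral_eq_lintegral_ofReal (integrable_circ (by fun_prop))
    (Eventually.of_forall fun y => by positivity)] at h
  simp only [nonlin_eq]
  refine h.trans_eq ?_
  simp only [avg]
  ring

theorem mean_sq_add_variance_le {g : ℝ → ℝ} (hg : Measurable g) :
    ENNReal.ofReal (2 * π) * ‖mean g‖ₑ ^ 2 +
      ENNReal.ofReal (4 * π)⁻¹ * ∫⁻ q, ‖g q.1 - g q.2‖ₑ ^ 2 ∂(circ.prod circ) ≤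
      ∫⁻ y, ‖g y‖ₑ ^ 2 ∂circ := by
  by_cases ht : ∫⁻ y, ‖g y‖ₑ ^ 2 ∂circ = ⊤
  · rw [ht]; exact le_top
  have h2 : Integrable (fun y => g y ^ 2) circ := by
    refine ⟨(hg.pow_const 2).aestronglyMeasurable, ?_⟩
    rw [HasFiniteIntegral]
    simp only [enorm_pow]
    exact lt_top_iff_ne_top.mpr ht
  have h1 : Integrable g circ := by
    refine ((integrable_const (1 : ℝ)).add h2).mono' hg.aestronglyMeasurable
      (Eventually.of_forall fun y => ?_)
    simp only [Pi.add_apply, Real.norm_eq_abs]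
    nlinarith [sq_nonneg (|g y| - 1), sq_abs (g y), abs_nonneg (g y)]
  have ha : Integrable (fun q : ℝ × ℝ => g q.1 ^ 2) (circ.prod circ) := h2.comp_fst circ
  have hb : Integrable (fun q : ℝ × ℝ => g q.2 ^ 2) (circ.prod circ) := h2.comp_snd circ
  have hc : Integrable (fun q : ℝ × ℝ => g q.1 * g q.2) (circ.prod circ) := h1.mul_prod h1
  have hd : ∀ q : ℝ × ℝ, (g q.1 - g q.2) ^ 2 = g q.1 ^ 2 + g q.2 ^ 2 - 2 * (g q.1 * g q.2) :=
    fun q => by ring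
  have hab : Integrable (fun q : ℝ × ℝ => g q.1 ^ 2 + g q.2 ^ 2) (circ.prod circ) := ha.add hb
  have hi : Integrable (fun q : ℝ × ℝ => (g q.1 - g q.2) ^ 2) (circ.prod circ) := by
    simp only [hd]; exact hab.sub (hc.const_mul 2)
  have hv : ∫ q, (g q.1 - g q.2) ^ 2 ∂(circ.prod circ) =
      4 * π * (∫ y, g y ^ 2 ∂circ) - 8 * π ^ 2 * mean g ^ 2 := by
    simp only [hd]
    rw [integral_sub hab (hc.const_mul 2), integral_add ha hb, integral_const_mul,
      integral_prod_mul, integral_fun_fst (fun y => g y ^ 2), integral_fun_snd (fun y => g y ^ 2),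
      circ_real_univ, smul_eq_mul, ← two_pi_mul_mean g]
    ring
  have hq : ∫⁻ q, ‖g q.1 - g q.2‖ₑ ^ 2 ∂(circ.prod circ) =
      ENNReal.ofReal (4 * π * (∫ y, g y ^ 2 ∂circ) - 8 * π ^ 2 * mean g ^ 2) := by
    rw [← hv, ofReal_integral_eq_lintegral_ofReal hi (Eventually.of_forall fun q => sq_nonneg _)]
    simp only [ofReal_sq_eq]
  have hy : ∫⁻ y, ‖g y‖ₑ ^ 2 ∂circ = ENNReal.ofReal (∫ y, g y ^ 2 ∂circ) := by
    rw [ofReal_integral_eq_lintegral_ofReal h2 (Eventually.of_forall fun q => sq_nonneg _)]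
    simp only [ofReal_sq_eq]
  have hnn : 0 ≤ 4 * π * (∫ y, g y ^ 2 ∂circ) - 8 * π ^ 2 * mean g ^ 2 :=
    hv ▸ integral_nonneg fun q => sq_nonneg _
  rw [hq, hy, ← ofReal_sq_eq, ← ENNReal.ofReal_mul two_pi_pos.le,
    ← ENNReal.ofReal_mul (by positivity), ← ENNReal.ofReal_add (by positivity)
    (mul_nonneg (by positivity) hnn)]
  refine (congrArg ENNReal.ofReal ?_).le
  field_simp
  ring

theorem avgGrad_add_eE_le {u : Pt → ℝ} :
    ENNReal.ofReal (2 * π) * (∫⁻ x, ∑ i, ‖avgGrad u x i‖ₑ ^ 2) +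
      ENNReal.ofReal (4 * π)⁻¹ * eE u ≤ eA u := by
  have hx := measurable_gradx u
  have hE : eE u = ∫⁻ x, ∫⁻ q, ∑ i, ‖gradx u (x, q.1) i - gradx u (x, q.2) i‖ₑ ^ 2
      ∂(circ.prod circ) ∂volume := by
    rw [eE, lintegral_lintegral_swap]
    have : Measurable fun p : (ℝ × ℝ) × Pt3 =>
        ∑ i, ‖gradx u (p.2, p.1.1) i - gradx u (p.2, p.1.2) i‖ₑ ^ 2 :=
      Finset.measurable_fun_sum _ fun i _ => (((hx i).comp (by fun_prop)).sub
        ((hx i).comp (by fun_prop))).enorm.pow_const 2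
    exact this.aemeasurable
  have hA : eA u = ∫⁻ x, ∫⁻ y, ∑ i, ‖gradx u (x, y) i‖ₑ ^ 2 ∂circ ∂volume := by
    rw [eA, lintegral_lintegral_swap]
    have : Measurable fun p : ℝ × Pt3 => ∑ i, ‖gradx u (p.2, p.1) i‖ₑ ^ 2 :=
      Finset.measurable_fun_sum _ fun i _ =>
        ((measurable_gradx u i).comp measurable_swap).enorm.pow_const 2
    exact this.aemeasurable
  have hm : Measurable fun x => ∑ i, ‖avgGrad u x i‖ₑ ^ 2 :=
    Finset.measurable_fun_sum _ fun i _ => (measurable_avgGrad u i).enorm.pow_const 2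
  rw [hE, hA, ← lintegral_const_mul' _ _ ENNReal.ofReal_ne_top,
    ← lintegral_const_mul' _ _ ENNReal.ofReal_ne_top, ← lintegral_add_left (hm.const_mul _)]
  refine lintegral_mono fun x => ?_
  have hy : ∀ i, Measurable fun y => gradx u (x, y) i := fun i => (hx i).comp (by fun_prop)
  have hq : ∀ i, Measurable fun q : ℝ × ℝ => ‖gradx u (x, q.1) i - gradx u (x, q.2) i‖ₑ ^ 2 :=
    fun i => (((hy i).comp measurable_fst).sub ((hy i).comp measurable_snd)).enorm.pow_const 2
  rw [lintegral_finsetSum _ fun i _ => (hy i).enorm.pow_const 2,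
    lintegral_finsetSum _ fun i _ => hq i, Finset.mul_sum, Finset.mul_sum,
    ← Finset.sum_add_distrib]
  exact Finset.sum_le_sum fun i _ => mean_sq_add_variance_le (hy i)

theorem integrableOn_comp_fst {F : Pt3 → ℝ} (hF : Integrable F) :
    IntegrableOn (fun p : Pt => F p.1) Dom := by
  rw [IntegrableOn, restrict_dom]
  exact hF.comp_fst circ

theorem integral_comp_fst (F : Pt3 → ℝ) : ∫ p : Pt in Dom, F p.1 = 2 * π * ∫ x, F x := by
  rw [restrict_dom, integral_fun_fst, circ_real_univ, smul_eq_mul]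

theorem integrable_comp_scale {F : Pt3 → ℝ} (hF : Integrable F) {τ : ℝ} (hτ : 0 < τ) :
    Integrable fun x => F (τ • x) := hF.comp_smul hτ.ne'

theorem integral_comp_scale (F : Pt3 → ℝ) {τ : ℝ} (hτ : 0 < τ) :
    ∫ x, F (τ • x) = (τ ^ 3)⁻¹ * ∫ x, F x := by
  rw [Measure.integral_comp_smul, Module.finrank_fin_fun, smul_eq_mul, abs_of_pos (by positivity)]

/-- The `y`-independent function `a f(τ x)`. -/
def cyl (a τ : ℝ) (f : Pt3 → ℝ) (p : Pt) : ℝ := a * f (τ • p.1)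

theorem hasFDerivAt_cyl (a τ : ℝ) {f : Pt3 → ℝ} (hf : Differentiable ℝ f) (p : Pt) :
    HasFDerivAt (cyl a τ f)
      (a • (fderiv ℝ f (τ • p.1)).comp (τ • ContinuousLinearMap.fst ℝ Pt3 ℝ)) p := by
  have h : HasFDerivAt (fun p : Pt => τ • p.1) (τ • ContinuousLinearMap.fst ℝ Pt3 ℝ) p :=
    hasFDerivAt_fst.const_smul τ
  exact (((hf (τ • p.1)).hasFDerivAt).comp p h).const_smul a

theorem gradx_cyl (a τ : ℝ) {f : Pt3 → ℝ} (hf : Differentiable ℝ f) (p : Pt) (i : Fin 3) :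
    gradx (cyl a τ f) p i = a * τ * grad3 f (τ • p.1) i := by
  rw [gradx, (hasFDerivAt_cyl a τ hf p).fderiv]
  simp only [_root_.smul_apply, ContinuousLinearMap.comp_apply,
    ContinuousLinearMap.coe_fst', map_smul, smul_eq_mul, ex, grad3]
  rw [mul_assoc]
  rfl

theorem grady_cyl (a τ : ℝ) {f : Pt3 → ℝ} (hf : Differentiable ℝ f) (p : Pt) :
    grady (cyl a τ f) p = 0 := by
  rw [grady, (hasFDerivAt_cyl a τ hf p).fderiv]
  simp [ey]

theorem gradSqX_cyl (a τ : ℝ) {f : Pt3 → ℝ} (hf : Differentiable ℝ f) (p : Pt) :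
    gradSqX (cyl a τ f) p = a ^ 2 * τ ^ 2 * gradSq3 f (τ • p.1) := by
  simp only [gradSqX, gradx_cyl a τ hf, gradSq3, Finset.mul_sum]
  exact Finset.sum_congr rfl fun i _ => by ring

theorem H1R3.cyl {f : Pt3 → ℝ} (hf : H1R3 f) (a : ℝ) {τ : ℝ} (hτ : 0 < τ) :
    H1 (cyl a τ f) where
  periodic := fun x y => rfl
  diff := fun p => (hasFDerivAt_cyl a τ hf.diff p).differentiableAt
  memL2 := by
    simp only [Waveguide.cyl, mul_pow]
    exact (integrableOn_comp_fst (integrable_comp_scale hf.memL2 hτ)).const_mul _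
  memGrad := by
    simp only [gradSq, gradSqX_cyl a τ hf.diff, grady_cyl a τ hf.diff]
    simp only [ne_eq, two_ne_zero, not_false_eq_true, zero_pow, add_zero]
    exact (integrableOn_comp_fst (integrable_comp_scale hf.memGrad hτ)).const_mul _
  memL4 := by
    simp only [Waveguide.cyl, mul_pow]
    exact (integrableOn_comp_fst (integrable_comp_scale hf.memL4 hτ)).const_mul _

theorem integral_cyl_sq (a : ℝ) {τ : ℝ} (hτ : 0 < τ) (f : Pt3 → ℝ) :
    ∫ p in Dom, cyl a τ f p ^ 2 = 2 * π * (a ^ 2 * ((τ ^ 3)⁻¹ * ∫ x, f x ^ 2)) := by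
  simp only [cyl, mul_pow]
  rw [integral_const_mul, integral_comp_fst (fun x => f (τ • x) ^ 2),
    integral_comp_scale (fun x => f x ^ 2) hτ]
  ring

theorem H1.Jfun_eq {u v : Pt → ℝ} (hu : H1 u) (hv : H1 v) (hQ : svirial u v = 0) (μ : ℝ) :
    Jfun μ u v = (1 / 6) * ((∫ p in Dom, gradSqX u p) + ∫ p in Dom, gradSqX v p) +
      (μ / 2) * ((∫ p in Dom, grady u p ^ 2) + ∫ p in Dom, grady v p ^ 2) := by
  have e : ∀ p, gradSqX u p + μ * (grady u p) ^ 2 + gradSqX v p + μ * (grady v p) ^ 2 =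
      (gradSqX u p + gradSqX v p) + μ * (grady u p ^ 2 + grady v p ^ 2) := fun p => by ring
  have h1 := hu.integrable_gradSqX
  have h2 := hv.integrable_gradSqX
  have h3 := hu.integrable_grady_sq
  have h4 := hv.integrable_grady_sq
  have h12 : IntegrableOn (fun p => gradSqX u p + gradSqX v p) Dom := h1.add h2
  have h34 : IntegrableOn (fun p => grady u p ^ 2 + grady v p ^ 2) Dom := h3.add h4
  rw [svirial, integral_add h1 h2] at hQ
  rw [Jfun]
  simp only [e]
  rw [integral_add h12 (h34.const_mul μ), integral_const_mul, integral_add h1 h2,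
    integral_add h3 h4]
  linarith

theorem H1.svirial_eq {u v : Pt → ℝ} (hu : H1 u) (hv : H1 v) :
    svirial u v = (∫ p in Dom, gradSqX u p) + (∫ p in Dom, gradSqX v p) -
      (3 / 4) * ∫ p in Dom, nonlin u v p := by
  rw [svirial, integral_add hu.integrable_gradSqX hv.integrable_gradSqX]

theorem H1.Jfun_nonneg {u v : Pt → ℝ} (hu : H1 u) (hv : H1 v) (hQ : svirial u v = 0) {μ : ℝ}
    (hμ : 0 ≤ μ) : 0 ≤ Jfun μ u v := by
  rw [hu.Jfun_eq hv hQ]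
  have h1 : 0 ≤ ∫ p in Dom, gradSqX u p := integral_nonneg fun p => gradSqX_nonneg u p
  have h2 : 0 ≤ ∫ p in Dom, gradSqX v p := integral_nonneg fun p => gradSqX_nonneg v p
  have h3 : 0 ≤ ∫ p in Dom, grady u p ^ 2 := integral_nonneg fun p => sq_nonneg _
  have h4 : 0 ≤ ∫ p in Dom, grady v p ^ 2 := integral_nonneg fun p => sq_nonneg _
  positivity

theorem m1_le {u v : Pt → ℝ} (hu : inS 1 u) (hv : inS 1 v) (hQ : svirial u v = 0) {μ : ℝ}
    (hμ : 0 ≤ μ) : m1 μ ≤ Jfun μ u v := by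
  refine csInf_le ⟨0, ?_⟩ ⟨u, v, hu, hv, hQ, rfl⟩
  rintro c ⟨u, v, hu, hv, hQ, rfl⟩
  exact hu.1.Jfun_nonneg hv.1 hQ hμ

theorem H1R3.integral_sq_eq_zero {f : Pt3 → ℝ} (hf : H1R3 f) (h : ∫ x, gradSq3 f x = 0) :
    ∫ x, f x ^ 2 = 0 := by
  have h0 : ∫⁻ x, eGradSq3 f x = 0 := by
    have := ofReal_integral_eq_lintegral_ofReal hf.memGrad (Eventually.of_forall fun x =>
      (Finset.sum_nonneg fun _ _ => sq_nonneg _ : 0 ≤ gradSq3 f x))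
    rw [h, ENNReal.ofReal_zero] at this
    simp_rw [gradSq3, ENNReal.ofReal_sum_of_nonneg fun i _ => sq_nonneg _, ofReal_sq_eq] at this
    exact this.symm
  have h2 : ∫⁻ x, ‖f x‖ₑ ^ 2 ≠ ⊤ := by
    have := ofReal_integral_eq_lintegral_ofReal hf.memL2 (Eventually.of_forall fun x => sq_nonneg _)
    simp only [ofReal_sq_eq] at this
    exact this ▸ ENNReal.ofReal_ne_top
  have h6 := lintegral_pow_six_le hf.diff h2
  rw [h0, zero_pow (by norm_num), mul_zero, nonpos_iff_eq_zero,
    lintegral_eq_zero_iff (hf.diff.continuous.measurable.enorm.pow_const 6)] at h6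
  rw [integral_eq_zero_of_ae]
  filter_upwards [h6] with x hx
  simpa using hx

theorem H1R3.integral_gradSq3_pos {f : Pt3 → ℝ} (hf : H1R3 f) (h : 0 < ∫ x, f x ^ 2) :
    0 < ∫ x, gradSq3 f x := by
  refine lt_of_le_of_ne (integral_nonneg fun x => Finset.sum_nonneg fun _ _ => sq_nonneg _) ?_
  exact fun h0 => h.ne' (hf.integral_sq_eq_zero h0.symm)

theorem H1R3.integrable_quartic {f g : Pt3 → ℝ} (hf : H1R3 f) (hg : H1R3 g) (a b : ℝ) :
    Integrable fun x => (a * f x ^ 2 + b * g x ^ 2) ^ 2 := by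
  have hm : Measurable fun x => (a * f x ^ 2 + b * g x ^ 2) ^ 2 := by
    have := hf.diff.continuous.measurable
    have := hg.diff.continuous.measurable
    fun_prop
  refine ((hf.memL4.const_mul (2 * a ^ 2)).add (hg.memL4.const_mul (2 * b ^ 2))).mono'
    hm.aestronglyMeasurable (Eventually.of_forall fun x => ?_)
  rw [Real.norm_of_nonneg (sq_nonneg _)]
  simp only [Pi.add_apply]
  nlinarith [sq_nonneg (a * f x ^ 2 - b * g x ^ 2)]

theorem H1R3.integral_quartic_pos {f g : Pt3 → ℝ} (hf : H1R3 f) (hg : H1R3 g) {a b : ℝ}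
    (ha : 0 < a) (hb : 0 ≤ b) (h : 0 < ∫ x, f x ^ 2) :
    0 < ∫ x, (a * f x ^ 2 + b * g x ^ 2) ^ 2 := by
  refine lt_of_le_of_ne (integral_nonneg fun x => sq_nonneg _) fun h0 => h.ne' ?_
  rw [eq_comm, integral_eq_zero_iff_of_nonneg (fun x => sq_nonneg _)
    (hf.integrable_quartic hg a b)] at h0
  rw [integral_eq_zero_of_ae]
  filter_upwards [h0] with x hx
  simp only [Pi.zero_apply] at hx ⊢
  have h1 := pow_eq_zero_iff (two_ne_zero) |>.mp hx
  have h2 : 0 ≤ b * g x ^ 2 := by positivity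
  have h3 : a * f x ^ 2 ≤ 0 := by linarith
  have h4 : 0 ≤ f x ^ 2 := sq_nonneg _
  nlinarith [mul_nonneg ha.le h4, (mul_eq_zero.mp (le_antisymm h3 (mul_nonneg ha.le h4)))]

/-- The level is bounded by the rescaled energy of normalised `y`-independent functions. -/
theorem m1_le_of_H1R3 {f g : Pt3 → ℝ} (hf : H1R3 f) (hg : H1R3 g) (hMf : 0 < ∫ x, f x ^ 2)
    (hMg : 0 < ∫ x, g x ^ 2) {μ : ℝ} (hμ : 0 ≤ μ) :
    m1 μ ≤ (8 / 27) * ((∫ x, gradSq3 f x) / (∫ x, f x ^ 2) +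
      (∫ x, gradSq3 g x) / ∫ x, g x ^ 2) ^ 3 / ((2 * π)⁻¹ *
        ∫ x, ((∫ x, f x ^ 2)⁻¹ * f x ^ 2 + (∫ x, g x ^ 2)⁻¹ * g x ^ 2) ^ 2) ^ 2 := by
  have hGf := hf.integral_gradSq3_pos hMf
  have hGg := hg.integral_gradSq3_pos hMg
  have hN0 := hf.integral_quartic_pos hg (inv_pos.mpr hMf) (inv_pos.mpr hMg).le hMf
  set Mf := ∫ x, f x ^ 2
  set Mg := ∫ x, g x ^ 2
  set Gf := ∫ x, gradSq3 f x
  set Gg := ∫ x, gradSq3 g x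
  set N0 := ∫ x, (Mf⁻¹ * f x ^ 2 + Mg⁻¹ * g x ^ 2) ^ 2 with hN0def
  set A1 := Gf / Mf + Gg / Mg
  have hA1 : 0 < A1 := by positivity
  set N1 := (2 * π)⁻¹ * N0 with hN1def
  have hN1 : 0 < N1 := by positivity
  set τ := 4 * A1 / (3 * N1) with hτdef
  have hτ : 0 < τ := by positivity
  set a := √(τ ^ 3 / (2 * π * Mf))
  set b := √(τ ^ 3 / (2 * π * Mg))
  have ha : a ^ 2 = τ ^ 3 / (2 * π * Mf) := Real.sq_sqrt (by positivity)
  have hb : b ^ 2 = τ ^ 3 / (2 * π * Mg) := Real.sq_sqrt (by positivity)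
  have hu := hf.cyl a hτ
  have hv := hg.cyl b hτ
  have huS : inS 1 (cyl a τ f) := by
    refine ⟨hu, ?_⟩
    rw [l2, integral_cyl_sq a hτ, ha, Real.sqrt_eq_one]
    field_simp
    rfl
  have hvS : inS 1 (cyl b τ g) := by
    refine ⟨hv, ?_⟩
    rw [l2, integral_cyl_sq b hτ, hb, Real.sqrt_eq_one]
    field_simp
    rfl
  have hAu : ∫ p in Dom, gradSqX (cyl a τ f) p = τ ^ 2 * (Gf / Mf) := by
    simp only [gradSqX_cyl a τ hf.diff]
    rw [integral_const_mul, integral_comp_fst (fun x => gradSq3 f (τ • x)),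
      integral_comp_scale (gradSq3 f) hτ, ha]
    field_simp
    rfl
  have hAv : ∫ p in Dom, gradSqX (cyl b τ g) p = τ ^ 2 * (Gg / Mg) := by
    simp only [gradSqX_cyl b τ hg.diff]
    rw [integral_const_mul, integral_comp_fst (fun x => gradSq3 g (τ • x)),
      integral_comp_scale (gradSq3 g) hτ, hb]
    field_simp
    rfl
  have hN : ∫ p in Dom, nonlin (cyl a τ f) (cyl b τ g) p = τ ^ 3 * N1 := by
    have e : ∀ p, nonlin (cyl a τ f) (cyl b τ g) p = (τ ^ 3 / (2 * π)) ^ 2 *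
        (Mf⁻¹ * f (τ • p.1) ^ 2 + Mg⁻¹ * g (τ • p.1) ^ 2) ^ 2 := fun p => by
      rw [nonlin_eq, cyl, cyl, mul_pow, mul_pow, ha, hb]
      field_simp
    simp only [e]
    rw [integral_const_mul, integral_comp_fst (fun x =>
      (Mf⁻¹ * f (τ • x) ^ 2 + Mg⁻¹ * g (τ • x) ^ 2) ^ 2), integral_comp_scale (fun x =>
      (Mf⁻¹ * f x ^ 2 + Mg⁻¹ * g x ^ 2) ^ 2) hτ, ← hN0def, hN1def]
    field_simp
  have hQ : svirial (cyl a τ f) (cyl b τ g) = 0 := by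
    rw [hu.svirial_eq hv, hAu, hAv, hN]
    have : τ ^ 2 * (Gf / Mf) + τ ^ 2 * (Gg / Mg) - 3 / 4 * (τ ^ 3 * N1) =
      τ ^ 2 * (A1 - 3 / 4 * (τ * N1)) := by ring
    rw [this, hτdef]
    field_simp
    ring
  refine (m1_le huS hvS hQ hμ).trans_eq ?_
  rw [hu.Jfun_eq hv hQ, hAu, hAv]
  simp only [grady_cyl _ τ hf.diff, grady_cyl _ τ hg.diff]
  rw [← mul_add, show Gf / Mf + Gg / Mg = A1 from rfl, hτdef]
  field_simp
  simp
  ring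

theorem m1_mul_le_of_H1R3 {f g : Pt3 → ℝ} (hf : H1R3 f) (hg : H1R3 g) {κ : ℝ} (hκ : 0 < κ)
    (hf1 : κ ≤ 2 * π * ∫ x, f x ^ 2) (hf2 : 2 * π * ∫ x, f x ^ 2 ≤ 1)
    (hg1 : κ ≤ 2 * π * ∫ x, g x ^ 2) (hg2 : 2 * π * ∫ x, g x ^ 2 ≤ 1) {μ : ℝ} (hμ : 0 ≤ μ) :
    m1 μ * κ ^ 3 * (2 * π * ∫ x, (f x ^ 2 + g x ^ 2) ^ 2) ^ 2 ≤
      (8 / 27) * (2 * π * ((∫ x, gradSq3 f x) + ∫ x, gradSq3 g x)) ^ 3 := by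
  have hMf : 0 < ∫ x, f x ^ 2 := pos_of_mul_pos_right (hκ.trans_le hf1) two_pi_pos.le
  have hMg : 0 < ∫ x, g x ^ 2 := pos_of_mul_pos_right (hκ.trans_le hg1) two_pi_pos.le
  have h := m1_le_of_H1R3 hf hg hMf hMg hμ
  have hGf := hf.integral_gradSq3_pos hMf
  have hGg := hg.integral_gradSq3_pos hMg
  have hq := hf.integral_quartic_pos hg one_pos zero_le_one hMf
  have hq2 := hf.integrable_quartic hg 1 1
  have hq3 := hf.integrable_quartic hg (∫ x, f x ^ 2)⁻¹ (∫ x, g x ^ 2)⁻¹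
  simp only [one_mul] at hq hq2
  have hN0 := hf.integral_quartic_pos hg (inv_pos.mpr hMf) (inv_pos.mpr hMg).le hMf
  set Mf := ∫ x, f x ^ 2
  set Mg := ∫ x, g x ^ 2
  set Gf := ∫ x, gradSq3 f x
  set Gg := ∫ x, gradSq3 g x
  set q := ∫ x, (f x ^ 2 + g x ^ 2) ^ 2
  set N0 := ∫ x, (Mf⁻¹ * f x ^ 2 + Mg⁻¹ * g x ^ 2) ^ 2 with hN0def
  have i1 : 2 * π ≤ Mf⁻¹ := by
    rw [le_inv_comm₀ two_pi_pos hMf, ← one_div, le_div_iff₀' two_pi_pos]; exact hf2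
  have i2 : 2 * π ≤ Mg⁻¹ := by
    rw [le_inv_comm₀ two_pi_pos hMg, ← one_div, le_div_iff₀' two_pi_pos]; exact hg2
  have j1 : κ * (Gf / Mf) ≤ 2 * π * Gf := by
    rw [← mul_div_assoc, div_le_iff₀ hMf]; nlinarith
  have j2 : κ * (Gg / Mg) ≤ 2 * π * Gg := by
    rw [← mul_div_assoc, div_le_iff₀ hMg]; nlinarith
  have hNle : 2 * π * q ≤ (2 * π)⁻¹ * N0 := by
    rw [inv_mul_eq_div, le_div_iff₀ two_pi_pos]
    have : 2 * π * q * (2 * π) = ∫ x, (2 * π) ^ 2 * (f x ^ 2 + g x ^ 2) ^ 2 := by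
      rw [integral_const_mul]; ring
    rw [this]
    refine integral_mono (hq2.const_mul _) hq3 fun x => ?_
    simp only
    rw [← mul_pow]
    have hp := two_pi_pos
    gcongr
    rw [mul_add]
    gcongr
  rw [le_div_iff₀ (by positivity)] at h
  by_cases hm : m1 μ < 0
  · refine le_trans (b := 0) ?_ (by positivity)
    have : 0 ≤ κ ^ 3 * (2 * π * q) ^ 2 := by positivity
    nlinarith
  push Not at hm
  calc m1 μ * κ ^ 3 * (2 * π * q) ^ 2 ≤ m1 μ * κ ^ 3 * ((2 * π)⁻¹ * N0) ^ 2 := by gcongr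
    _ = κ ^ 3 * (m1 μ * ((2 * π)⁻¹ * N0) ^ 2) := by ring
    _ ≤ κ ^ 3 * (8 / 27 * (Gf / Mf + Gg / Mg) ^ 3) := by gcongr
    _ = 8 / 27 * (κ * (Gf / Mf) + κ * (Gg / Mg)) ^ 3 := by ring
    _ ≤ _ := by rw [mul_add (2 * π)]; gcongr

theorem H1R3.of_contDiff {f : Pt3 → ℝ} (hf : ContDiff ℝ 1 f) (hc : HasCompactSupport f) :
    H1R3 f where
  diff := hf.differentiable one_ne_zero
  memL2 := by
    refine Continuous.integrable_of_hasCompactSupport (by have := hf.continuous; fun_prop) ?_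
    exact hc.comp_left (g := fun t => t ^ 2) (by simp)
  memL4 := by
    refine Continuous.integrable_of_hasCompactSupport (by have := hf.continuous; fun_prop) ?_
    exact hc.comp_left (g := fun t => t ^ 4) (by simp)
  memGrad := by
    have h1 := hf.continuous_fderiv one_ne_zero
    refine Continuous.integrable_of_hasCompactSupport (by unfold gradSq3 grad3; fun_prop) ?_
    exact (hc.fderiv ℝ).comp_left (g := fun L : Pt3 →L[ℝ] ℝ => ∑ i, L (e3 i) ^ 2) (by simp)

theorem exists_m1_le : ∃ M, ∀ μ, 0 ≤ μ → m1 μ ≤ M := by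
  let b : ContDiffBump (0 : Pt3) := ⟨1, 2, one_pos, one_lt_two⟩
  have hb : H1R3 b := H1R3.of_contDiff b.contDiff b.hasCompactSupport
  have h2 : 0 < ∫ x, b x ^ 2 := by
    refine (integral_pos_iff_support_of_nonneg (fun x => sq_nonneg _) hb.memL2).mpr ?_
    have : Metric.ball (0 : Pt3) 2 ⊆ Function.support fun x => b x ^ 2 := fun x hx => by
      have : 0 < b x := b.pos_of_mem_ball hx
      simp [this.ne']
    exact (Metric.measure_ball_pos volume _ two_pos).trans_le (measure_mono this)
  exact ⟨_, fun μ hμ => m1_le_of_H1R3 hb hb h2 h2 hμ⟩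

theorem integrable_mul_translate {a : Pt3 → ℝ} (ha : Measurable a)
    (ha2 : Integrable fun t => a t ^ 2) {b : Pt → ℝ} (hb : Measurable b)
    (hb2 : IntegrableOn (fun p => b p ^ 2) Dom) (x : Pt3) :
    Integrable (fun p : Pt => a p.1 * b (x - p.1, p.2)) (volume.prod circ) := by
  rw [IntegrableOn, restrict_dom] at hb2
  have hmp : MeasurePreserving (fun p : Pt => (x - p.1, p.2)) ((volume : Measure Pt3).prod circ)
      ((volume : Measure Pt3).prod circ) :=
    (Measure.measurePreserving_sub_left volume x).prod (MeasurePreserving.id circ)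
  have h1 : Integrable (fun p : Pt => b (x - p.1, p.2) ^ 2) (volume.prod circ) :=
    hmp.integrable_comp_of_integrable hb2
  have h2 : Integrable (fun p : Pt => a p.1 ^ 2) (volume.prod circ) := ha2.comp_fst circ
  refine (h2.add h1).mono' ?_ (Eventually.of_forall fun p => ?_)
  · exact ((ha.comp measurable_fst).mul (hb.comp hmp.measurable)).aestronglyMeasurable
  · rw [norm_mul, Real.norm_eq_abs, Real.norm_eq_abs]
    simp only [Pi.add_apply]
    nlinarith [sq_nonneg (|a p.1| - |b (x - p.1, p.2)|), sq_abs (a p.1),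
      sq_abs (b (x - p.1, p.2)), sq_nonneg (|a p.1|), sq_nonneg (|b (x - p.1, p.2)|)]

theorem integral_mul_mean_translate {a : Pt3 → ℝ} (ha : Measurable a)
    (ha2 : Integrable fun t => a t ^ 2) {b : Pt → ℝ} (hb : Measurable b)
    (hb2 : IntegrableOn (fun p => b p ^ 2) Dom) (x : Pt3) :
    ∫ t, a t * mean (fun y => b (x - t, y)) =
      (2 * π)⁻¹ * ∫ y, ∫ t, a t * b (x - t, y) ∂volume ∂circ := by
  have h := integral_integral_swap (f := fun t y => a t * b (x - t, y))
    (integrable_mul_translate ha ha2 hb hb2 x)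
  rw [← h, ← integral_const_mul]
  refine integral_congr_ae (Eventually.of_forall fun t => ?_)
  simp only [mean, integral_const_mul]
  ring

theorem H1.integrable_gradx_sq {u : Pt → ℝ} (hu : H1 u) (i : Fin 3) :
    IntegrableOn (fun p => gradx u p i ^ 2) Dom := by
  refine hu.integrable_gradSqX.mono' ((measurable_gradx u i).pow_const 2).aestronglyMeasurable
    (Eventually.of_forall fun p => ?_)
  rw [Real.norm_of_nonneg (sq_nonneg _)]
  exact Finset.single_le_sum (f := fun i => gradx u p i ^ 2) (fun _ _ => sq_nonneg _)
    (Finset.mem_univ i)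

theorem H1.hasLineDerivAt_translate {u : Pt → ℝ} (hu : H1 u) (x t : Pt3) (y : ℝ) (i : Fin 3) :
    HasLineDerivAt ℝ (fun t => u (x - t, y)) (-gradx u (x - t, y) i) t (e3 i) := by
  have h0 := hasFDerivAt_slice hu.diff (x - t) y
  have hs : HasFDerivAt (fun t : Pt3 => x - t) (-ContinuousLinearMap.id ℝ Pt3) t :=
    (hasFDerivAt_id t).const_sub x
  have h4 := (h0.comp t hs).hasLineDerivAt (e3 i)
  have h5 : gradx u (x - t, y) i = grad3 (fun x => u (x, y)) (x - t) i := by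
    rw [grad3_slice hu.diff]
  rw [h5, grad3, h0.fderiv, ← map_neg]
  exact h4

theorem H1.integral_grad3_mul_slice {u : Pt → ℝ} (hu : H1 u) {k : Pt3 → ℝ} (hk : ContDiff ℝ 1 k)
    (x : Pt3) (y : ℝ) (i : Fin 3) (h1 : Integrable fun t => grad3 k t i * u (x - t, y))
    (h2 : Integrable fun t => k t * gradx u (x - t, y) i)
    (h3 : Integrable fun t => k t * u (x - t, y)) :
    ∫ t, grad3 k t i * u (x - t, y) = ∫ t, k t * gradx u (x - t, y) i := by
  have hlk : ∀ t, HasLineDerivAt ℝ k (grad3 k t i) t (e3 i) := fun t =>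
    (hk.differentiable one_ne_zero t).hasFDerivAt.hasLineDerivAt _
  have hn : Integrable fun t => k t * -gradx u (x - t, y) i := by
    simp only [mul_neg]
    exact h2.neg
  have hB := integral_bilinear_hasLineDerivAt_right_eq_neg_left_of_integrable
    (μ := (volume : Measure Pt3)) (B := ContinuousLinearMap.mul ℝ ℝ) (f := k)
    (f' := fun t => grad3 k t i) (g := fun t => u (x - t, y))
    (g' := fun t => -gradx u (x - t, y) i) (v := e3 i) h1 hn h3
    (fun t _ => hlk t) (fun t _ => hu.hasLineDerivAt_translate x t y i)
  simp only [ContinuousLinearMap.mul_apply', mul_neg, integral_neg, neg_inj] at hB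
  exact hB.symm

/-- The `y`-average of the gradient is the weak gradient of the `y`-average. -/
theorem H1.integral_grad3_mul_avg {u : Pt → ℝ} (hu : H1 u) {k : Pt3 → ℝ} (hk : ContDiff ℝ 1 k)
    (hc : HasCompactSupport k) (x : Pt3) (i : Fin 3) :
    ∫ t, grad3 k t i * avg u (x - t) = ∫ t, k t * avgGrad u (x - t) i := by
  have hkm := hk.continuous.measurable
  have hk2 := (H1R3.of_contDiff hk hc).memL2
  have hdc : Continuous fun t => grad3 k t i := by
    have := hk.continuous_fderiv one_ne_zero
    unfold grad3; fun_prop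
  have hd2 : Integrable fun t => grad3 k t i ^ 2 :=
    (H1R3.of_contDiff hk hc).memGrad.mono' (hdc.pow 2).aestronglyMeasurable
      (Eventually.of_forall fun t => by
        rw [Real.norm_of_nonneg (sq_nonneg _)]
        exact Finset.single_le_sum (f := fun i => grad3 k t i ^ 2) (fun _ _ => sq_nonneg _)
          (Finset.mem_univ i))
  have hum := hu.diff.continuous.measurable
  have hgm := measurable_gradx u i
  have hg2 := hu.integrable_gradx_sq i
  simp only [avg, avgGrad]
  rw [integral_mul_mean_translate hdc.measurable hd2 hum hu.memL2 x,
    integral_mul_mean_translate hkm hk2 hgm hg2 x]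
  congr 1
  refine integral_congr_ae ?_
  filter_upwards [(integrable_mul_translate hdc.measurable hd2 hum hu.memL2 x).prod_left_ae,
    (integrable_mul_translate hkm hk2 hgm hg2 x).prod_left_ae,
    (integrable_mul_translate hkm hk2 hum hu.memL2 x).prod_left_ae] with y h1 h2 h3
  exact hu.integral_grad3_mul_slice hk x y i h1 h2 h3

/-- Convolution of scalar functions on `ℝ³`. -/
def conv (k w : Pt3 → ℝ) : Pt3 → ℝ :=
  convolution k w (ContinuousLinearMap.lsmul ℝ ℝ) volume

theorem conv_apply (k w : Pt3 → ℝ) (x : Pt3) : conv k w x = ∫ t, k t * w (x - t) := by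
  simp [conv, convolution]

theorem contDiff_conv {k w : Pt3 → ℝ} (hk : ContDiff ℝ 1 k) (hc : HasCompactSupport k)
    (hw : Continuous w) : ContDiff ℝ 1 (conv k w) :=
  hc.contDiff_convolution_left (n := 1) (ContinuousLinearMap.lsmul ℝ ℝ) hk hw.locallyIntegrable

theorem grad3_conv {k w : Pt3 → ℝ} (hk : ContDiff ℝ 1 k) (hc : HasCompactSupport k)
    (hw : Continuous w) (x : Pt3) (i : Fin 3) :
    grad3 (conv k w) x i = ∫ t, grad3 k t i * w (x - t) := by
  have h := hc.hasFDerivAt_convolution_left (ContinuousLinearMap.lsmul ℝ ℝ) hk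
    (hw.locallyIntegrable (μ := volume)) x
  have he := (hc.fderiv ℝ).convolutionExists_left
    (ContinuousLinearMap.precompL Pt3 (ContinuousLinearMap.lsmul ℝ ℝ : ℝ →L[ℝ] ℝ →L[ℝ] ℝ))
    (hk.continuous_fderiv one_ne_zero) (hw.locallyIntegrable (μ := volume)) x
  rw [grad3, conv, h.fderiv, convolution, ContinuousLinearMap.integral_apply he]
  simp [grad3]

theorem sq_lintegral_le {ν : Measure Pt3} [IsProbabilityMeasure ν] {F : Pt3 → ENNReal}
    (hF : Measurable F) : (∫⁻ t, F t ∂ν) ^ 2 ≤ ∫⁻ t, F t ^ 2 ∂ν := by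
  have h := ENNReal.lintegral_mul_le_Lp_mul_Lq ν Real.HolderConjugate.two_two
    (measurable_const (a := (1 : ENNReal))).aemeasurable hF.aemeasurable
  simp only [Pi.mul_apply, one_mul, ENNReal.rpow_two, one_pow, lintegral_one, measure_univ,
    ENNReal.one_rpow] at h
  calc (∫⁻ t, F t ∂ν) ^ 2 ≤ ((∫⁻ t, F t ^ 2 ∂ν) ^ ((1 : ℝ) / 2)) ^ 2 := by gcongr
    _ = _ := by simp only [← ENNReal.rpow_natCast, ← ENNReal.rpow_mul]; norm_num

/-- Averaging over translations is an `L²` contraction. -/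
theorem lintegral_conv_sq_le {k w : Pt3 → ℝ} (hk : Continuous k) (hk0 : ∀ t, 0 ≤ k t)
    (hki : Integrable k) (hk1 : ∫ t, k t = 1) (hw : Measurable w) :
    ∫⁻ x, ‖∫ t, k t * w (x - t)‖ₑ ^ 2 ≤ ∫⁻ x, ‖w x‖ₑ ^ 2 := by
  have hkm : Measurable fun t => ENNReal.ofReal (k t) := hk.measurable.ennreal_ofReal
  set ν := (volume : Measure Pt3).withDensity fun t => ENNReal.ofReal (k t) with hν
  have hprob : IsProbabilityMeasure ν := ⟨by
    rw [hν, withDensity_apply _ MeasurableSet.univ, Measure.restrict_univ,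
      ← ofReal_integral_eq_lintegral_ofReal hki (Eventually.of_forall hk0), hk1,
      ENNReal.ofReal_one]⟩
  have hpt : ∀ x, ‖∫ t, k t * w (x - t)‖ₑ ^ 2 ≤ ∫⁻ t, ‖w (x - t)‖ₑ ^ 2 ∂ν := fun x => by
    have hm : Measurable fun t => ‖w (x - t)‖ₑ := (hw.comp (by fun_prop)).enorm
    refine le_trans ?_ (sq_lintegral_le hm)
    gcongr
    refine (enorm_integral_le_lintegral_enorm _).trans_eq ?_
    rw [hν, lintegral_withDensity_eq_lintegral_mul _ hkm hm]
    refine lintegral_congr fun t => ?_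
    rw [enorm_mul, Real.enorm_of_nonneg (hk0 t)]
    rfl
  have hm2 : Measurable fun p : Pt3 × Pt3 => ‖w (p.1 - p.2)‖ₑ ^ 2 :=
    (hw.comp (by fun_prop)).enorm.pow_const 2
  calc _ ≤ ∫⁻ x, ∫⁻ t, ‖w (x - t)‖ₑ ^ 2 ∂ν := lintegral_mono hpt
    _ = ∫⁻ t, ∫⁻ x, ‖w (x - t)‖ₑ ^ 2 ∂volume ∂ν :=
        lintegral_lintegral_swap (f := fun x t => ‖w (x - t)‖ₑ ^ 2) hm2.aemeasurable
    _ = ∫⁻ t, ∫⁻ x, ‖w x‖ₑ ^ 2 ∂volume ∂ν := lintegral_congr fun t =>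
        lintegral_sub_right_eq_self (fun x => ‖w x‖ₑ ^ 2) t
    _ = _ := by rw [lintegral_const, measure_univ, mul_one]

theorem H1R3.of_lintegral {w : Pt3 → ℝ} (hw : Differentiable ℝ w)
    (h2 : ∫⁻ x, ‖w x‖ₑ ^ 2 ≠ ⊤) (hg : ∫⁻ x, eGradSq3 w x ≠ ⊤) : H1R3 w := by
  have hm := hw.continuous.measurable
  have h6 : ∫⁻ x, ‖w x‖ₑ ^ 6 ≠ ⊤ :=
    ne_top_of_le_ne_top (by finiteness) (lintegral_pow_six_le hw h2)
  have i2 : Integrable fun x => w x ^ 2 :=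
    ⟨(hm.pow_const 2).aestronglyMeasurable, by
      simpa only [HasFiniteIntegral, enorm_pow] using lt_top_iff_ne_top.mpr h2⟩
  have i6 : Integrable fun x => w x ^ 6 :=
    ⟨(hm.pow_const 6).aestronglyMeasurable, by
      simpa only [HasFiniteIntegral, enorm_pow] using lt_top_iff_ne_top.mpr h6⟩
  have hgm : Measurable (gradSq3 w) :=
    Finset.measurable_fun_sum _ fun i _ => (measurable_grad3 w i).pow_const 2
  refine ⟨hw, i2, ⟨hgm.aestronglyMeasurable, ?_⟩, (i2.add i6).mono'
    (hm.pow_const 4).aestronglyMeasurable (Eventually.of_forall fun x => ?_)⟩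
  · rw [HasFiniteIntegral]
    convert lt_top_iff_ne_top.mpr hg using 3 with x
    have h0 : 0 ≤ gradSq3 w x := Finset.sum_nonneg fun _ _ => sq_nonneg _
    rw [Real.enorm_of_nonneg h0, gradSq3,
      ENNReal.ofReal_sum_of_nonneg fun i _ => sq_nonneg _]
    simp only [ofReal_sq_eq, eGradSq3]
  · rw [Real.norm_of_nonneg (by positivity)]
    simp only [Pi.add_apply]
    nlinarith [mul_nonneg (sq_nonneg (w x)) (sq_nonneg (w x ^ 2 - 1)), sq_nonneg (w x),
      sq_nonneg (w x ^ 3)]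

theorem H1R3.ofReal_mass {w : Pt3 → ℝ} (hw : H1R3 w) :
    ENNReal.ofReal (∫ x, w x ^ 2) = ∫⁻ x, ‖w x‖ₑ ^ 2 := by
  rw [ofReal_integral_eq_lintegral_ofReal hw.memL2 (Eventually.of_forall fun x => sq_nonneg _)]
  simp only [ofReal_sq_eq]

theorem H1R3.ofReal_grad {w : Pt3 → ℝ} (hw : H1R3 w) :
    ENNReal.ofReal (∫ x, gradSq3 w x) = ∫⁻ x, eGradSq3 w x := by
  rw [ofReal_integral_eq_lintegral_ofReal hw.memGrad (Eventually.of_forall fun x =>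
      (Finset.sum_nonneg fun _ _ => sq_nonneg _ : 0 ≤ gradSq3 w x))]
  simp_rw [gradSq3, ENNReal.ofReal_sum_of_nonneg fun i _ => sq_nonneg _, ofReal_sq_eq]
  rfl

/-- The `y`-average of an `H¹` function is the pointwise limit of functions on `ℝ³` whose `L²` norm
and Dirichlet energy do not exceed those of the average. -/
theorem H1.exists_mollification {u : Pt → ℝ} (hu : H1 u) (hm : ∫⁻ x, ‖avg u x‖ₑ ^ 2 ≠ ⊤)
    (hg : ∫⁻ x, ∑ i, ‖avgGrad u x i‖ₑ ^ 2 ≠ ⊤) :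
    ∃ w : ℕ → Pt3 → ℝ, (∀ n, H1R3 (w n)) ∧
      (∀ n, ∫⁻ x, ‖w n x‖ₑ ^ 2 ≤ ∫⁻ x, ‖avg u x‖ₑ ^ 2) ∧
      (∀ n, ∫⁻ x, eGradSq3 (w n) x ≤ ∫⁻ x, ∑ i, ‖avgGrad u x i‖ₑ ^ 2) ∧
      ∀ x, Tendsto (fun n => w n x) atTop (nhds (avg u x)) := by
  let φ : ℕ → ContDiffBump (0 : Pt3) := fun n =>
    ⟨1 / (2 * ((n : ℝ) + 1)), 1 / ((n : ℝ) + 1), by positivity,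
      one_div_lt_one_div_of_lt (by positivity) (by linarith [n.cast_nonneg (α := ℝ)])⟩
  have hφ : Tendsto (fun n => (φ n).rOut) atTop (nhds 0) := tendsto_one_div_add_atTop_nhds_zero_nat
  have hcont := continuous_avg hu.diff.continuous
  have hk : ∀ n, ContDiff ℝ 1 ((φ n).normed volume) := fun n => (φ n).contDiff_normed
  have hc : ∀ n, HasCompactSupport ((φ n).normed volume) := fun n => (φ n).hasCompactSupport_normed
  have hcd := fun n => contDiff_conv (hk n) (hc n) hcont
  have hL : ∀ n, ∀ w : Pt3 → ℝ, Measurable w →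
      ∫⁻ x, ‖∫ t, (φ n).normed volume t * w (x - t)‖ₑ ^ 2 ≤ ∫⁻ x, ‖w x‖ₑ ^ 2 := fun n w hw =>
    lintegral_conv_sq_le (hk n).continuous (φ n).nonneg_normed (φ n).integrable_normed
      (φ n).integral_normed hw
  have hm' : ∀ n, ∫⁻ x, ‖conv ((φ n).normed volume) (avg u) x‖ₑ ^ 2 ≤ ∫⁻ x, ‖avg u x‖ₑ ^ 2 :=
    fun n => by
      simp only [conv_apply]
      exact hL n _ hcont.measurable
  have hg' : ∀ n, ∫⁻ x, eGradSq3 (conv ((φ n).normed volume) (avg u)) x ≤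
      ∫⁻ x, ∑ i, ‖avgGrad u x i‖ₑ ^ 2 := fun n => by
    have hmg := measurable_grad3 (conv ((φ n).normed volume) (avg u))
    unfold eGradSq3
    rw [lintegral_finsetSum _ fun i _ => (hmg i).enorm.pow_const 2,
      lintegral_finsetSum _ fun i _ => (measurable_avgGrad u i).enorm.pow_const 2]
    refine Finset.sum_le_sum fun i _ => ?_
    simp only [grad3_conv (hk n) (hc n) hcont, hu.integral_grad3_mul_avg (hk n) (hc n)]
    exact hL n _ (measurable_avgGrad u i)
  refine ⟨fun n => conv ((φ n).normed volume) (avg u), fun n => H1R3.of_lintegral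
    ((hcd n).differentiable one_ne_zero) (ne_top_of_le_ne_top hm (hm' n))
    (ne_top_of_le_ne_top hg (hg' n)), hm', hg', fun x => ?_⟩
  exact ContDiffBump.convolution_tendsto_right_of_continuous hφ hcont x

theorem eventually_lt_lintegral {F : ℕ → Pt3 → ENNReal} {F₀ : Pt3 → ENNReal}
    (hF : ∀ n, Measurable (F n)) (ht : ∀ x, Tendsto (fun n => F n x) atTop (nhds (F₀ x)))
    {c : ENNReal} (hc : c < ∫⁻ x, F₀ x) : ∀ᶠ n in atTop, c < ∫⁻ x, F n x := by
  refine eventually_lt_of_lt_liminf (hc.trans_le ?_)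
  refine le_trans (le_of_eq ?_) (lintegral_liminf_le hF)
  exact lintegral_congr fun x => (ht x).liminf_eq.symm

theorem m1_mul_le_of_tendsto {μ κ n a : ℝ} {f g : Pt3 → ℝ} {fs gs : ℕ → Pt3 → ℝ}
    (hfs : ∀ j, H1R3 (fs j)) (hgs : ∀ j, H1R3 (gs j))
    (hft : ∀ x, Tendsto (fun j => fs j x) atTop (nhds (f x)))
    (hgt : ∀ x, Tendsto (fun j => gs j x) atTop (nhds (g x)))
    (hμ : 0 ≤ μ) (hm : 0 ≤ m1 μ) (hκ : 0 < κ) (hn : 0 < n)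
    (hf1 : ENNReal.ofReal κ ≤ ∫⁻ x, ENNReal.ofReal (2 * π * f x ^ 2))
    (hg1 : ENNReal.ofReal κ ≤ ∫⁻ x, ENNReal.ofReal (2 * π * g x ^ 2))
    (hf2 : ∀ j, 2 * π * ∫ x, fs j x ^ 2 ≤ 1) (hg2 : ∀ j, 2 * π * ∫ x, gs j x ^ 2 ≤ 1)
    (hN : ENNReal.ofReal n ≤ ∫⁻ x, ENNReal.ofReal (2 * π * (f x ^ 2 + g x ^ 2) ^ 2))
    (ha : ∀ j, 2 * π * ((∫ x, gradSq3 (fs j) x) + ∫ x, gradSq3 (gs j) x) ≤ a) :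
    m1 μ * κ ^ 3 * n ^ 2 ≤ 8 / 27 * a ^ 3 := by
  have hp := Real.pi_pos
  have hfm := fun j => (hfs j).diff.continuous.measurable
  have hgm := fun j => (hgs j).diff.continuous.measurable
  have hmass : ∀ {w : Pt3 → ℝ} {ws : ℕ → Pt3 → ℝ} {s : ℝ}, s < 1 → (∀ j, H1R3 (ws j)) →
      (∀ x, Tendsto (fun j => ws j x) atTop (nhds (w x))) →
      ENNReal.ofReal κ ≤ ∫⁻ x, ENNReal.ofReal (2 * π * w x ^ 2) →
      ∀ᶠ j in atTop, s * κ ≤ 2 * π * ∫ x, ws j x ^ 2 := by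
    intro w ws s hs hws ht hle
    have h1 : ENNReal.ofReal (s * κ) < ∫⁻ x, ENNReal.ofReal (2 * π * w x ^ 2) :=
      lt_of_lt_of_le ((ENNReal.ofReal_lt_ofReal_iff hκ).2 (by nlinarith)) hle
    have h2 := eventually_lt_lintegral (F := fun j x => ENNReal.ofReal (2 * π * ws j x ^ 2))
      (fun j => (((hws j).diff.continuous.measurable.pow_const 2).const_mul _).ennreal_ofReal)
      (fun x => ENNReal.tendsto_ofReal (((ht x).pow 2).const_mul _)) h1
    filter_upwards [h2] with j hj
    rw [← ofReal_integral_eq_lintegral_ofReal ((hws j).memL2.const_mul _)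
      (Eventually.of_forall fun x => by positivity), integral_const_mul] at hj
    exact (ENNReal.ofReal_lt_ofReal_iff'.1 hj).1.le
  have hnl : ∀ {s : ℝ}, s < 1 → ∀ᶠ j in atTop,
      s * n ≤ 2 * π * ∫ x, (fs j x ^ 2 + gs j x ^ 2) ^ 2 := by
    intro s hs
    have h1 : ENNReal.ofReal (s * n) <
        ∫⁻ x, ENNReal.ofReal (2 * π * (f x ^ 2 + g x ^ 2) ^ 2) :=
      lt_of_lt_of_le ((ENNReal.ofReal_lt_ofReal_iff hn).2 (by nlinarith)) hN
    have h2 := eventually_lt_lintegral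
      (F := fun j x => ENNReal.ofReal (2 * π * (fs j x ^ 2 + gs j x ^ 2) ^ 2))
      (fun j => (((((hfm j).pow_const 2).add ((hgm j).pow_const 2)).pow_const
        2).const_mul _).ennreal_ofReal)
      (fun x => ENNReal.tendsto_ofReal
        (((((hft x).pow 2).add ((hgt x).pow 2)).pow 2).const_mul _)) h1
    filter_upwards [h2] with j hj
    have hi : Integrable fun x => (fs j x ^ 2 + gs j x ^ 2) ^ 2 := by
      simpa only [one_mul] using H1R3.integrable_quartic (hfs j) (hgs j) 1 1
    rw [← ofReal_integral_eq_lintegral_ofReal (hi.const_mul _)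
      (Eventually.of_forall fun x => by positivity), integral_const_mul] at hj
    exact (ENNReal.ofReal_lt_ofReal_iff'.1 hj).1.le
  have key : ∀ s : ℝ, s ∈ Set.Ioo (0 : ℝ) 1 →
      m1 μ * (s * κ) ^ 3 * (s * n) ^ 2 ≤ 8 / 27 * a ^ 3 := by
    rintro s ⟨hs0, hs1⟩
    obtain ⟨j, h1, h2, h3⟩ := ((hmass hs1 hfs hft hf1).and
      ((hmass hs1 hgs hgt hg1).and (hnl hs1))).exists
    have h := m1_mul_le_of_H1R3 (hfs j) (hgs j) (mul_pos hs0 hκ) h1 (hf2 j) h2 (hg2 j) hμ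
    have hgr : ∀ w : Pt3 → ℝ, 0 ≤ ∫ x, gradSq3 w x := fun w =>
      integral_nonneg fun x => Finset.sum_nonneg fun _ _ => sq_nonneg _
    calc _ ≤ m1 μ * (s * κ) ^ 3 * (2 * π * ∫ x, (fs j x ^ 2 + gs j x ^ 2) ^ 2) ^ 2 := by
          gcongr
      _ ≤ _ := h
      _ ≤ _ := by
          have := hgr (fs j)
          have := hgr (gs j)
          gcongr
          exact ha j
  have hlim : Tendsto (fun s : ℝ => m1 μ * (s * κ) ^ 3 * (s * n) ^ 2) (nhdsWithin 1 (Set.Iio 1))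
      (nhds (m1 μ * (1 * κ) ^ 3 * (1 * n) ^ 2)) :=
    ((by fun_prop : Continuous fun s : ℝ => m1 μ * (s * κ) ^ 3 * (s * n) ^ 2).tendsto
      1).mono_left nhdsWithin_le_nhds
  simpa only [one_mul] using le_of_tendsto hlim
    (Filter.eventually_of_mem (Ioo_mem_nhdsLT zero_lt_one) key)

theorem eq_zero_of_reduced_inequality {A B E P μ m M : ℝ} (hA : 0 < A) (hB : 0 ≤ B) (hE : 0 ≤ E)
    (hEA : E ≤ A) (hP : 0 ≤ P) (hμ : 0 < μ) (hm : m = 1 / 6 * A + μ / 2 * B) (hmM : m ≤ M)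
    (hsmall : M * (12 * P / μ + 15360 / √μ) < 1 / 6)
    (h : ∀ κ n, 0 < κ → 0 < n → κ ≤ 1 - 4 * P * B →
      n ≤ 4 / 3 * A - 20480 * A * √(E * B) → m * κ ^ 3 * n ^ 2 ≤ 8 / 27 * (A - E) ^ 3) :
    B = 0 := by
  have hs : 0 < √μ := Real.sqrt_pos.2 hμ
  have hμB : 0 ≤ μ * B := by positivity
  have hm0 : 0 ≤ m := by rw [hm]; positivity
  have hM0 : 0 ≤ M := hm0.trans hmM
  have hsq : √(E * B) ≤ (E + μ * B) / (2 * √μ) := by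
    rw [Real.sqrt_le_left (by positivity), div_pow, mul_pow, Real.sq_sqrt hμ.le,
      le_div_iff₀ (by positivity)]
    nlinarith [sq_nonneg (E - μ * B)]
  set D := E + μ * B with hD
  have hD0 : 0 ≤ D := by positivity
  have hDM : D ≤ 6 * M := by linarith
  set t := 15360 * √(E * B) with ht
  have ht0 : 0 ≤ t := by positivity
  have htD : t ≤ 7680 * D / √μ := by
    calc t ≤ 15360 * (D / (2 * √μ)) := by rw [ht]; gcongr
      _ = _ := by ring
  have hBD : B ≤ D / μ := by rw [le_div_iff₀ hμ]; linarith
  have h1 : M * (12 * P / μ) < 1 / 6 := by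
    have : 0 ≤ M * (15360 / √μ) := by positivity
    linarith [mul_add M (12 * P / μ) (15360 / √μ)]
  have h2 : M * (15360 / √μ) < 1 / 6 := by
    have : 0 ≤ M * (12 * P / μ) := by positivity
    linarith [mul_add M (12 * P / μ) (15360 / √μ)]
  have ht1 : t < 1 := by
    calc t ≤ 7680 * (6 * M) / √μ := htD.trans (by gcongr)
      _ = 3 * (M * (15360 / √μ)) := by ring
      _ < 1 := by linarith
  have hx0 : 0 ≤ 4 * P * B := by positivity
  have hx1 : 4 * P * B < 1 := by
    have hB2 : B ≤ 2 * M / μ := by rw [le_div_iff₀ hμ]; linarith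
    calc 4 * P * B ≤ 4 * P * (2 * M / μ) := by gcongr
      _ = 2 / 3 * (M * (12 * P / μ)) := by ring
      _ < 1 := by linarith
  have key := h (1 - 4 * P * B) (4 / 3 * A * (1 - t)) (by linarith)
    (mul_pos (by positivity) (by linarith)) le_rfl (by rw [ht]; linarith)
  set x := 4 * P * B with hx
  have hcube : (A - E) ^ 3 ≤ A ^ 2 * (A - E) := by
    nlinarith [mul_nonneg (sub_nonneg.2 hEA) (mul_nonneg hE (by linarith : 0 ≤ 2 * A - E))]
  have hred : m * ((1 - x) ^ 3 * (1 - t) ^ 2) ≤ (A - E) / 6 := by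
    refine le_of_mul_le_mul_left ?_ (by positivity : 0 < 16 / 9 * A ^ 2)
    linarith
  have hx3 : 1 - 3 * x ≤ (1 - x) ^ 3 := by nlinarith [mul_nonneg (sq_nonneg x) (by linarith : 0 ≤ 3 - x)]
  have hbern : 1 - 3 * x - 2 * t ≤ (1 - x) ^ 3 * (1 - t) ^ 2 := by
    have hy0 : 0 ≤ (1 - x) ^ 3 := pow_nonneg (by linarith) 3
    have hy1 : (1 - x) ^ 3 ≤ 1 := pow_le_one₀ (by linarith) (by linarith)
    generalize (1 - x) ^ 3 = y at hx3 hy0 hy1 ⊢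
    linarith [mul_nonneg hy0 (sq_nonneg t), mul_nonneg (sub_nonneg.2 hy1) ht0]
  have hfin : D / 6 ≤ M * (3 * x + 2 * t) := by
    have h3 := (mul_le_mul_of_nonneg_left hbern hm0).trans hred
    have h4 : m * (3 * x + 2 * t) ≤ M * (3 * x + 2 * t) := by gcongr
    rw [hm] at h3 h4
    linarith
  have hlast : D / 6 ≤ M * (12 * P / μ + 15360 / √μ) * D := by
    calc D / 6 ≤ M * (3 * (4 * P * (D / μ)) + 2 * (7680 * D / √μ)) := hfin.trans (by
          rw [hx]; gcongr)
      _ = _ := by ring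
  have hDz : D = 0 := by
    by_contra hne
    have := mul_lt_mul_of_pos_right hsmall (lt_of_le_of_ne hD0 (Ne.symm hne))
    linarith
  have : μ * B = 0 := by linarith
  exact (mul_eq_zero.1 this).resolve_left hμ.ne'

theorem eventually_small (M P : ℝ) :
    ∀ᶠ μ : ℝ in atTop, M * (12 * P / μ + 15360 / √μ) < 1 / 6 := by
  have h : Tendsto (fun μ : ℝ => M * (12 * P / μ + 15360 / √μ)) atTop (nhds (M * (0 + 0))) :=
    ((tendsto_const_nhds.div_atTop tendsto_id).add
      (tendsto_const_nhds.div_atTop Real.tendsto_sqrt_atTop)).const_mul M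
  exact h.eventually_lt_const (by norm_num)

theorem H1.inter_le_ofReal {f g : Pt → ℝ} (hf : H1 f) (hg : H1 g) {E B : ℝ} (hE : 0 ≤ E)
    (hEf : eE f ≤ ENNReal.ofReal (4 * π * E)) (hB : ∫ p in Dom, grady f p ^ 2 ≤ B) :
    inter f g ≤ ENNReal.ofReal (512 * π * √(E * B) * ∫ p in Dom, gradSqX g p) := by
  have hp := Real.pi_pos
  have hB0 : 0 ≤ B := le_trans (integral_nonneg fun p => sq_nonneg _) hB
  have hs : √(32768 * (4 * π * E) * (B * (2 * π))) = 512 * π * √(E * B) := by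
    rw [show 32768 * (4 * π * E) * (B * (2 * π)) = (512 * π) ^ 2 * (E * B) by ring,
      Real.sqrt_mul (sq_nonneg _), Real.sqrt_sq (by positivity)]
  refine (hf.inter_le hg).trans ?_
  rw [hg.eA_eq, ← hs, ENNReal.ofReal_mul (Real.sqrt_nonneg _), ← mul_assoc]
  gcongr
  rw [Real.sqrt_eq_rpow, ← ENNReal.ofReal_rpow_of_nonneg (by positivity) (by norm_num),
    ENNReal.ofReal_mul (by positivity : 0 ≤ 32768 * (4 * π * E)),
    ENNReal.ofReal_mul (by norm_num : (0 : ℝ) ≤ 32768), ENNReal.ofReal_mul hB0, ENNReal.ofReal_ofNat,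
    hf.eB_eq, ← mul_assoc]
  simp only [ENNReal.mul_rpow_of_nonneg _ _ (by norm_num : (0 : ℝ) ≤ 1 / 2), ← mul_assoc]
  gcongr

/-- The data of a normalised `H¹` function which enter the comparison with the problem on `ℝ³`. -/
theorem inS.exists_reduction {u : Pt → ℝ} (hu : inS 1 u) :
    ∃ (E : ℝ) (w : ℕ → Pt3 → ℝ), 0 ≤ E ∧ E ≤ ∫ p in Dom, gradSqX u p ∧
      eE u = ENNReal.ofReal (4 * π * E) ∧ (∀ j, H1R3 (w j)) ∧
      (∀ x, Tendsto (fun j => w j x) atTop (nhds (avg u x))) ∧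
      (∀ j, 2 * π * ∫ x, w j x ^ 2 ≤ 1) ∧
      (∀ j, 2 * π * ∫ x, gradSq3 (w j) x ≤ (∫ p in Dom, gradSqX u p) - E) ∧
      ENNReal.ofReal (1 - 4 * π ^ 2 * ∫ p in Dom, grady u p ^ 2) ≤
        ∫⁻ x, ENNReal.ofReal (2 * π * avg u x ^ 2) := by
  obtain ⟨hu, hl⟩ := hu
  have hp := Real.pi_pos
  have hA0 : 0 ≤ ∫ p in Dom, gradSqX u p := integral_nonneg fun p => gradSqX_nonneg u p
  have hmass : ∫⁻ x, ∫⁻ y, ‖u (x, y)‖ₑ ^ 2 ∂circ ∂volume = 1 := by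
    rw [← hu.mass_eq, (Real.sqrt_eq_one).1 hl, ENNReal.ofReal_one]
  have hcm := (continuous_avg hu.diff.continuous).measurable
  have hle : ENNReal.ofReal (2 * π) * (∫⁻ x, ‖avg u x‖ₑ ^ 2) ≤ 1 := by
    rw [← hmass, ← lintegral_const_mul _ (hcm.enorm.pow_const 2)]
    refine lintegral_mono fun x => ?_
    exact le_self_add.trans
      (mean_sq_add_variance_le (hu.diff.continuous.measurable.comp measurable_prodMk_left))
  have hgrad := avgGrad_add_eE_le (u := u)
  rw [hu.eA_eq] at hgrad
  have hEtop : eE u ≠ ⊤ := fun h => by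
    rw [h, ENNReal.mul_top (by simp [hp])] at hgrad
    simp at hgrad
  set G := ∫⁻ x, ∑ i, ‖avgGrad u x i‖ₑ ^ 2 with hG
  set A := ∫ p in Dom, gradSqX u p
  set E := (4 * π)⁻¹ * (eE u).toReal with hEdef
  have hE0 : 0 ≤ E := by positivity
  have hEE : eE u = ENNReal.ofReal (4 * π * E) := by
    rw [hEdef, mul_inv_cancel_left₀ (by positivity), ENNReal.ofReal_toReal hEtop]
  have hEr : ENNReal.ofReal (4 * π)⁻¹ * eE u = ENNReal.ofReal E := by
    rw [hEdef, ENNReal.ofReal_mul (by positivity), ENNReal.ofReal_toReal hEtop]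
  rw [hEr] at hgrad
  have hEA : E ≤ A := (ENNReal.ofReal_le_ofReal_iff hA0).1 (le_add_self.trans hgrad)
  have hGle : ENNReal.ofReal (2 * π) * G ≤ ENNReal.ofReal (A - E) := by
    rw [ENNReal.ofReal_sub _ hE0]
    exact ENNReal.le_sub_of_add_le_right ENNReal.ofReal_ne_top hgrad
  have h2p : ENNReal.ofReal (2 * π) ≠ 0 := by simp [hp]
  have hmt : ∫⁻ x, ‖avg u x‖ₑ ^ 2 ≠ ⊤ := fun h => by
    rw [h, ENNReal.mul_top h2p] at hle
    simp at hle
  have hGt : G ≠ ⊤ := fun h => by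
    rw [h, ENNReal.mul_top h2p] at hGle
    simp at hGle
  obtain ⟨w, hw, hwm, hwg, hwt⟩ := hu.exists_mollification hmt hGt
  refine ⟨E, w, hE0, hEA, hEE, hw, hwt, fun j => ?_, fun j => ?_, ?_⟩
  · rw [← ENNReal.ofReal_le_one, ENNReal.ofReal_mul (by positivity), (hw j).ofReal_mass]
    exact le_trans (mul_le_mul_right (hwm j) _) hle
  · rw [← ENNReal.ofReal_le_ofReal_iff (sub_nonneg.2 hEA), ENNReal.ofReal_mul (by positivity),
      (hw j).ofReal_grad]
    exact le_trans (mul_le_mul_right (hwg j) _) hGle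
  · have h := hu.mass_le
    rw [hmass, hu.eB_eq, ← ENNReal.ofReal_mul (by positivity)] at h
    rw [ENNReal.ofReal_sub _ (by positivity), ENNReal.ofReal_one]
    simp only [ENNReal.ofReal_mul two_pi_pos.le, ofReal_sq_eq]
    rw [lintegral_const_mul _ (hcm.enorm.pow_const 2)]
    exact tsub_le_iff_right.2 h

theorem m1_mul_le_of_inS {u v : Pt → ℝ} (hu : inS 1 u) (hv : inS 1 v) {μ : ℝ} (hμ : 0 ≤ μ)
    (hm : 0 ≤ m1 μ) :
    ∃ E : ℝ, 0 ≤ E ∧ E ≤ (∫ p in Dom, gradSqX u p) + ∫ p in Dom, gradSqX v p ∧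
      ∀ κ n : ℝ, 0 < κ → 0 < n →
        κ ≤ 1 - 4 * π ^ 2 * ((∫ p in Dom, grady u p ^ 2) + ∫ p in Dom, grady v p ^ 2) →
        n ≤ (∫ p in Dom, nonlin u v p) - 20480 * ((∫ p in Dom, gradSqX u p) +
          ∫ p in Dom, gradSqX v p) * √(E * ((∫ p in Dom, grady u p ^ 2) +
          ∫ p in Dom, grady v p ^ 2)) →
        m1 μ * κ ^ 3 * n ^ 2 ≤
          8 / 27 * ((∫ p in Dom, gradSqX u p) + (∫ p in Dom, gradSqX v p) - E) ^ 3 := by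
  obtain ⟨E, w, hE0, hEA, hEe, hw, hwt, hw2, hwg, hwk⟩ := hu.exists_reduction
  obtain ⟨F, z, hF0, hFA, hFe, hz, hzt, hz2, hzg, hzk⟩ := hv.exists_reduction
  have hp := Real.pi_pos
  have hBu : 0 ≤ ∫ p in Dom, grady u p ^ 2 := integral_nonneg fun p => sq_nonneg _
  have hBv : 0 ≤ ∫ p in Dom, grady v p ^ 2 := integral_nonneg fun p => sq_nonneg _
  have hN := hu.1.nonlin_le hv.1
  have hEs : eE u ≤ ENNReal.ofReal (4 * π * (E + F)) := by rw [hEe]; gcongr; linarith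
  have hFs : eE v ≤ ENNReal.ofReal (4 * π * (E + F)) := by rw [hFe]; gcongr; linarith
  have hEF : 0 ≤ E + F := add_nonneg hE0 hF0
  set Au := ∫ p in Dom, gradSqX u p
  set Av := ∫ p in Dom, gradSqX v p
  set Bu := ∫ p in Dom, grady u p ^ 2
  set Bv := ∫ p in Dom, grady v p ^ 2
  have hA0 : 0 ≤ Au := hE0.trans hEA
  have hA1 : 0 ≤ Av := hF0.trans hFA
  refine ⟨E + F, hEF, add_le_add hEA hFA, fun κ n hκ hn hκB hnN => ?_⟩
  set S := √((E + F) * (Bu + Bv))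
  have hS : 0 ≤ S := Real.sqrt_nonneg _
  have i1 : inter u u ≤ ENNReal.ofReal (512 * π * S * Au) :=
    hu.1.inter_le_ofReal hu.1 hEF hEs (le_add_of_nonneg_right hBv)
  have i2 : inter v u ≤ ENNReal.ofReal (512 * π * S * Au) :=
    hv.1.inter_le_ofReal hu.1 hEF hFs (le_add_of_nonneg_left hBu)
  have i3 : inter u v ≤ ENNReal.ofReal (512 * π * S * Av) :=
    hu.1.inter_le_ofReal hv.1 hEF hEs (le_add_of_nonneg_right hBv)
  have i4 : inter v v ≤ ENNReal.ofReal (512 * π * S * Av) :=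
    hv.1.inter_le_ofReal hv.1 hEF hFs (le_add_of_nonneg_left hBu)
  have herr : 20 * ENNReal.ofReal π⁻¹ * ((inter u u + inter v u) + (inter u v + inter v v)) ≤
      ENNReal.ofReal (20480 * (Au + Av) * S) := by
    refine (mul_le_mul_right (add_le_add (add_le_add i1 i2) (add_le_add i3 i4)) _).trans_eq ?_
    rw [← ENNReal.ofReal_ofNat 20, ← ENNReal.ofReal_add (by positivity) (by positivity),
      ← ENNReal.ofReal_add (by positivity) (by positivity),
      ← ENNReal.ofReal_add (by positivity) (by positivity),
      ← ENNReal.ofReal_mul (by norm_num), ← ENNReal.ofReal_mul (by positivity)]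
    congr 1
    field_simp
    ring
  have hNn : ENNReal.ofReal n ≤
      ∫⁻ x, ENNReal.ofReal (2 * π * (avg u x ^ 2 + avg v x ^ 2) ^ 2) := by
    refine (ENNReal.ofReal_le_ofReal hnN).trans ?_
    rw [ENNReal.ofReal_sub _ (by positivity)]
    exact tsub_le_iff_right.2 (hN.trans (by gcongr))
  refine m1_mul_le_of_tendsto hw hz hwt hzt hμ hm hκ hn
    ((ENNReal.ofReal_le_ofReal ?_).trans hwk) ((ENNReal.ofReal_le_ofReal ?_).trans hzk)
    hw2 hz2 hNn fun j => ?_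
  · nlinarith [mul_nonneg (sq_nonneg π) hBv]
  · nlinarith [mul_nonneg (sq_nonneg π) hBu]
  · rw [mul_add]
    linarith [hwg j, hzg j]

theorem inS.integral_gradSqX_pos {u v : Pt → ℝ} (hu : inS 1 u) (hv : H1 v)
    (hQ : svirial u v = 0) : 0 < (∫ p in Dom, gradSqX u p) + ∫ p in Dom, gradSqX v p := by
  rw [hu.1.svirial_eq hv] at hQ
  have hN0 : 0 ≤ ∫ p in Dom, nonlin u v p := integral_nonneg fun p => nonlin_nonneg u v p
  refine lt_of_le_of_ne (by linarith) fun h0 => ?_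
  have hN : ∫ p in Dom, nonlin u v p = 0 := by linarith
  have hae := (setIntegral_eq_zero_iff_of_nonneg_ae (Eventually.of_forall fun p =>
    nonlin_nonneg u v p) (hu.1.integrable_nonlin hv)).1 hN
  have hz : ∫ p in Dom, u p ^ 2 = 0 := by
    rw [integral_eq_zero_of_ae]
    filter_upwards [hae] with p hp
    have hp : nonlin u v p = 0 := hp
    rw [nonlin_eq] at hp
    have := pow_eq_zero_iff two_ne_zero |>.1 hp
    show u p ^ 2 = 0
    nlinarith [sq_nonneg (u p), sq_nonneg (v p)]
  have := (Real.sqrt_eq_one).1 hu.2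
  linarith

theorem grady_add_int_mul {u : Pt → ℝ} (hu : H1 u) (k : ℤ) (x : Pt3) (y : ℝ) :
    grady u (x, y + k * (2 * π)) = grady u (x, y) := by
  have hper : Function.Periodic (fun y => u (x, y)) (2 * π) := fun y => hu.periodic x y
  have h := (hasDerivAt_vertical hu.diff x (y + k * (2 * π))).comp_add_const y (k * (2 * π))
  have he : (fun y => u (x, y + k * (2 * π))) = fun y => u (x, y) :=
    funext fun y => hper.int_mul k y
  rw [he] at h
  exact h.unique (hasDerivAt_vertical hu.diff x y)

/-- If `u_y` vanishes almost everywhere on the fundamental domain, it does so everywhere. -/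
theorem H1.yindep_of_integral_eq_zero {u : Pt → ℝ} (hu : H1 u)
    (h : ∫ p in Dom, grady u p ^ 2 = 0) : Yindep u := by
  have hae : ∀ᵐ p ∂(volume.restrict Dom), grady u p = 0 := by
    filter_upwards [(setIntegral_eq_zero_iff_of_nonneg_ae (Eventually.of_forall fun p =>
      sq_nonneg _) hu.integrable_grady_sq).1 h] with p hp
    exact pow_eq_zero_iff two_ne_zero |>.1 hp
  have hDm : MeasurableSet Dom := MeasurableSet.univ.prod measurableSet_Ioc
  rw [ae_restrict_iff' hDm] at hae
  have hall : ∀ k : ℤ, ∀ᵐ p : Pt ∂volume, (p.1, p.2 + k * (2 * π)) ∈ Dom →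
      grady u (p.1, p.2 + k * (2 * π)) = 0 := fun k => by
    have hmp : MeasurePreserving (fun p : Pt => (p.1, p.2 + k * (2 * π)))
        ((volume : Measure Pt3).prod volume) ((volume : Measure Pt3).prod volume) :=
      (MeasurePreserving.id volume).prod (measurePreserving_add_right volume _)
    exact hmp.quasiMeasurePreserving.ae hae
  filter_upwards [ae_all_iff.2 hall] with p hp
  obtain ⟨k, hk, -⟩ := existsUnique_add_zsmul_mem_Ioc two_pi_pos p.2 0
  have := hp k ⟨Set.mem_univ _, by simpa [zsmul_eq_mul] using hk⟩
  rwa [grady_add_int_mul hu] at this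

theorem isMinimizerJ.yindep {u v : Pt → ℝ} {μ M : ℝ} (h : isMinimizerJ μ u v) (hμ : 0 < μ)
    (hM : m1 μ ≤ M) (hsmall : M * (12 * π ^ 2 / μ + 15360 / √μ) < 1 / 6) :
    Yindep u ∧ Yindep v := by
  obtain ⟨hu, hv, hQ, hJ⟩ := h
  have hm : 0 ≤ m1 μ := hJ ▸ hu.1.Jfun_nonneg hv.1 hQ hμ.le
  have hA := hu.integral_gradSqX_pos hv.1 hQ
  obtain ⟨E, hE0, hEA, hE⟩ := m1_mul_le_of_inS hu hv hμ.le hm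
  have hBu : 0 ≤ ∫ p in Dom, grady u p ^ 2 := integral_nonneg fun p => sq_nonneg _
  have hBv : 0 ≤ ∫ p in Dom, grady v p ^ 2 := integral_nonneg fun p => sq_nonneg _
  rw [hu.1.Jfun_eq hv.1 hQ] at hJ
  rw [hu.1.svirial_eq hv.1] at hQ
  have hB := eq_zero_of_reduced_inequality hA (add_nonneg hBu hBv) hE0 hEA (sq_nonneg π) hμ
    hJ.symm hM hsmall fun κ n hκ hn hκB hnN => hE κ n hκ hn hκB (by linarith)
  exact ⟨hu.1.yindep_of_integral_eq_zero (by linarith), hv.1.yindep_of_integral_eq_zero (by linarith)⟩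

/-- along any sequence `μ_j → ∞`, minimizers of `m_{1,μ_j}` are eventually
independent of the `y` variable. -/
theorem eventually_y_independent (μs : ℕ → ℝ)
    (hμ : Filter.Tendsto μs Filter.atTop Filter.atTop)
    (U V : ℕ → Pt → ℝ) (h : ∀ j : ℕ, isMinimizerJ (μs j) (U j) (V j)) :
    ∃ j₀ : ℕ, ∀ j : ℕ, j > j₀ → Yindep (U j) ∧ Yindep (V j) := by
  obtain ⟨M, hM⟩ := exists_m1_le
  obtain ⟨j₀, hj⟩ := eventually_atTop.1
    (hμ.eventually ((eventually_gt_atTop 0).and (eventually_small M (π ^ 2))))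
  exact ⟨j₀, fun j hlt => (h j).yindep (hj j hlt.le).1 (hM _ (hj j hlt.le).1.le) (hj j hlt.le).2⟩

end Waveguide
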